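/- Let P and Q be probability distributions on finite sets, neither of which is a uniform distribution (so V(P) > 0 and V(Q) > 0), suppose H(P)/V(P) > H(Q)/V(Q), let b ∈ ℝ, and let α be the unique real solution of N_P(x)/N_{P,Q,b}(x) = G_P(x)/G_{P,Q,b}(x). Then lim_{n→∞} F^D(P^n → Q^{⌊(H(P)/H(Q))n + b√n⌋}) = lim_{n→∞} F^M(P^n → Q^{⌊(H(P)/H(Q))n + b√n⌋}) = √(G_P(α)·G_{P,Q,b}(α)) + I_{P,Q,b}(∞) − I_{P,Q,b}(α) (in particular both limits exist). -/

import Mathlib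

open MeasureTheory Filter

namespace RNG

variable {α β : Type*}

/-- `P` is a probability distribution on the finite set `α`. -/
def IsProb [Fintype α] (P : α → ℝ) : Prop :=
  (∀ x, 0 ≤ P x) ∧ ∑ x, P x = 1

open Classical in
/-- Pushforward distribution `W(P)(y) = ∑_{x : W x = y} P x`. -/
noncomputable def push [Fintype α] (W : α → β) (P : α → ℝ) : β → ℝ :=
  fun y => ∑ x, if W x = y then P x else 0

/-- Fidelity (Bhattacharyya coefficient) between distributions on the same finite set. -/
noncomputable def fid [Fintype β] (R S : β → ℝ) : ℝ :=
  ∑ y, Real.sqrt (R y * S y)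

/-- Sum of the `l` largest values of `P`, i.e. the `l`-th partial sum of the
decreasing rearrangement of `P` (padded with zeros). -/
noncomputable def topSum [Fintype α] (P : α → ℝ) (l : ℕ) : ℝ :=
  sSup {s : ℝ | ∃ A : Finset α, A.card ≤ l ∧ s = ∑ x ∈ A, P x}

/-- Majorization `P ≺ P'` (the distributions may live on different finite sets). -/
def Maj [Fintype α] [Fintype β] (P : α → ℝ) (P' : β → ℝ) : Prop :=
  ∀ l : ℕ, topSum P l ≤ topSum P' l

/-- Maximal fidelity under deterministic transformations,
`F^D(P → Q) = max {F(W(P), Q) | W : α → β}`. -/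
noncomputable def FD [Fintype α] [Fintype β] (P : α → ℝ) (Q : β → ℝ) : ℝ :=
  sSup {r : ℝ | ∃ W : α → β, r = fid (push W P) Q}

/-- Maximal fidelity under the majorization condition,
`F^M(P → Q) = max {F(P', Q) | P ≺ P', P'` a distribution on the target set`}`. -/
noncomputable def FM [Fintype α] [Fintype β] (P : α → ℝ) (Q : β → ℝ) : ℝ :=
  sSup {r : ℝ | ∃ P' : β → ℝ, IsProb P' ∧ Maj P P' ∧ r = fid P' Q}

/-- Shannon entropy (natural logarithm). -/
noncomputable def H [Fintype α] (P : α → ℝ) : ℝ := ∑ x, -(P x * Real.log (P x))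

/-- Varentropy `V(P)` (natural logarithm). -/
noncomputable def V [Fintype α] (P : α → ℝ) : ℝ :=
  ∑ x, P x * (-Real.log (P x) - H P) ^ 2

/-- Shannon entropy, base-2 logarithm. -/
noncomputable def H2 [Fintype α] (P : α → ℝ) : ℝ := ∑ x, -(P x * Real.logb 2 (P x))

/-- Varentropy, base-2 logarithm. -/
noncomputable def V2 [Fintype α] (P : α → ℝ) : ℝ :=
  ∑ x, P x * (-Real.logb 2 (P x) - H2 P) ^ 2

/-- The `n`-fold i.i.d. product distribution `P^n`. -/
noncomputable def iid [Fintype α] (P : α → ℝ) (n : ℕ) : (Fin n → α) → ℝ :=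
  fun f => ∏ i, P (f i)

/-- The uniform distribution on a two-element set. -/
noncomputable def U2 : Fin 2 → ℝ := fun _ => 1 / 2

/-- Density of the normal distribution `N(m, v)`. -/
noncomputable def normalPDF (m v t : ℝ) : ℝ :=
  (Real.sqrt (2 * Real.pi * v))⁻¹ * Real.exp (-(t - m) ^ 2 / (2 * v))

/-- Standard normal cumulative distribution function `G`. -/
noncomputable def stdG (x : ℝ) : ℝ := ∫ t in Set.Iic x, normalPDF 0 1 t

/-- Density `N_P` of `N(0, V(P))`. -/
noncomputable def NP [Fintype α] (P : α → ℝ) (x : ℝ) : ℝ := normalPDF 0 (V P) x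

/-- Density `N_{P,Q,b}` of `N(H(Q)b, (H(P)/H(Q))·V(Q))`. -/
noncomputable def NPQ [Fintype α] [Fintype β] (P : α → ℝ) (Q : β → ℝ) (b x : ℝ) : ℝ :=
  normalPDF (H Q * b) (H P / H Q * V Q) x

/-- Cdf `G_P(x) = G(x/√V(P))`. -/
noncomputable def GP [Fintype α] (P : α → ℝ) (x : ℝ) : ℝ := stdG (x / Real.sqrt (V P))

/-- Cdf `G_{P,Q,b}(x) = G(√(H(Q)/(H(P)V(Q)))·(x − H(Q)b))`. -/
noncomputable def GPQ [Fintype α] [Fintype β] (P : α → ℝ) (Q : β → ℝ) (b x : ℝ) : ℝ :=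
  stdG (Real.sqrt (H Q / (H P * V Q)) * (x - H Q * b))

/-- `I_{P,Q,b}(x) = ∫_{−∞}^x √(N_P(t) N_{P,Q,b}(t)) dt`. -/
noncomputable def IPQ [Fintype α] [Fintype β] (P : α → ℝ) (Q : β → ℝ) (b x : ℝ) : ℝ :=
  ∫ t in Set.Iic x, Real.sqrt (NP P t * NPQ P Q b t)

/-- `I_{P,Q,b}(∞) = ∫_ℝ √(N_P(t) N_{P,Q,b}(t)) dt`. -/
noncomputable def IPQinf [Fintype α] [Fintype β] (P : α → ℝ) (Q : β → ℝ) (b : ℝ) : ℝ :=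
  ∫ t : ℝ, Real.sqrt (NP P t * NPQ P Q b t)

/-- `L^D_n(P,Q|ν)`: the maximal `L` with `F^D(P^n → Q^L) ≥ ν`. -/
noncomputable def LD [Fintype α] [Fintype β] (P : α → ℝ) (Q : β → ℝ) (ν : ℝ) (n : ℕ) : ℕ :=
  sSup {L : ℕ | ν ≤ FD (iid P n) (iid Q L)}

/-- The optimal second order rate `R^D_2(P,Q|ν)`. -/
noncomputable def RD2 [Fintype α] [Fintype β] (P : α → ℝ) (Q : β → ℝ) (ν : ℝ) : ℝ :=
  sSup {b : ℝ | ∃ c : ℝ, ν ≤ c ∧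
    Tendsto (fun n : ℕ =>
      FD (iid P n) (iid Q (⌊H P / H Q * n + b * Real.sqrt n⌋₊))) atTop (nhds c)}

theorem push_eq_sum_filter [Fintype α] [DecidableEq β] (W : α → β) (P : α → ℝ) (y : β) :
    push W P y = ∑ x with W x = y, P x := by
  classical
  unfold push
  rw [Finset.sum_filter]
  exact Finset.sum_congr rfl fun x _ => by congr

theorem IsProb.push [Fintype α] [Fintype β] {P : α → ℝ} (hP : IsProb P) (W : α → β) :
    IsProb (push W P) := by
  classical
  refine ⟨fun y => ?_, ?_⟩
  · rw [push_eq_sum_filter]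
    exact Finset.sum_nonneg fun x _ => hP.1 x
  · rw [← hP.2, ← Finset.sum_fiberwise Finset.univ W P]
    exact Finset.sum_congr rfl fun y _ => push_eq_sum_filter W P y

theorem fid_le_one [Fintype β] {R S : β → ℝ} (hR : IsProb R) (hS : IsProb S) :
    fid R S ≤ 1 := by
  unfold fid
  have h : ∀ y, Real.sqrt (R y * S y) ≤ (R y + S y) / 2 := fun y => by
    rw [Real.sqrt_le_iff]
    have := hR.1 y
    have := hS.1 y
    exact ⟨by positivity, by nlinarith [sq_nonneg (R y - S y)]⟩
  calc _ ≤ ∑ y, (R y + S y) / 2 := Finset.sum_le_sum fun y _ => h y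
    _ = 1 := by rw [← Finset.sum_div, Finset.sum_add_distrib, hR.2, hS.2]; norm_num

theorem bddAbove_topSum [Fintype α] (P : α → ℝ) (l : ℕ) :
    BddAbove {s : ℝ | ∃ A : Finset α, A.card ≤ l ∧ s = ∑ x ∈ A, P x} := by
  refine ⟨∑ x, |P x|, ?_⟩
  rintro s ⟨A, -, rfl⟩
  calc ∑ x ∈ A, P x ≤ ∑ x ∈ A, |P x| := Finset.sum_le_sum fun x _ => le_abs_self _
    _ ≤ _ := Finset.sum_le_sum_of_subset_of_nonneg (Finset.subset_univ _) fun _ _ _ => abs_nonneg _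

theorem sum_le_topSum [Fintype α] (P : α → ℝ) {l : ℕ} {A : Finset α} (hA : A.card ≤ l) :
    ∑ x ∈ A, P x ≤ topSum P l :=
  le_csSup (bddAbove_topSum P l) ⟨A, hA, rfl⟩

theorem topSum_le [Fintype α] {P : α → ℝ} {l : ℕ} {c : ℝ}
    (h : ∀ A : Finset α, A.card ≤ l → ∑ x ∈ A, P x ≤ c) : topSum P l ≤ c := by
  refine csSup_le ⟨0, ∅, by simp, by simp⟩ ?_
  rintro s ⟨A, hA, rfl⟩
  exact h A hA

theorem topSum_mono [Fintype α] (P : α → ℝ) : Monotone (topSum P) := fun _ _ h =>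
  topSum_le fun _ hA => sum_le_topSum P (hA.trans h)

theorem topSum_nonneg [Fintype α] (P : α → ℝ) (l : ℕ) : 0 ≤ topSum P l := by
  simpa using sum_le_topSum P (A := ∅) (l := l) (by simp)

theorem maj_push [Fintype α] [Fintype β] {P : α → ℝ} (hP : IsProb P) (W : α → β) :
    Maj P (push W P) := by
  classical
  refine fun l => topSum_le fun A hA => ?_
  refine le_trans ?_ (sum_le_topSum _ (A := A.image W) (Finset.card_image_le.trans hA))
  rw [← Finset.sum_fiberwise_of_maps_to (t := A.image W) (g := W)
    fun x hx => Finset.mem_image_of_mem W hx]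
  refine Finset.sum_le_sum fun y _ => ?_
  rw [push_eq_sum_filter]
  exact Finset.sum_le_sum_of_subset_of_nonneg (Finset.filter_subset_filter _ (Finset.subset_univ _))
    fun x _ _ => hP.1 x

theorem bddAbove_FM [Fintype α] [Fintype β] (P : α → ℝ) {Q : β → ℝ} (hQ : IsProb Q) :
    BddAbove {r : ℝ | ∃ P' : β → ℝ, IsProb P' ∧ Maj P P' ∧ r = fid P' Q} := by
  refine ⟨1, ?_⟩
  rintro _ ⟨P', hP', -, rfl⟩
  exact fid_le_one hP' hQ

theorem bddAbove_FD [Fintype α] [Fintype β] {P : α → ℝ} (hP : IsProb P) {Q : β → ℝ}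
    (hQ : IsProb Q) : BddAbove {r : ℝ | ∃ W : α → β, r = fid (push W P) Q} := by
  refine ⟨1, ?_⟩
  rintro _ ⟨W, rfl⟩
  exact fid_le_one (hP.push W) hQ

theorem IsProb.nonempty [Fintype β] {Q : β → ℝ} (hQ : IsProb Q) : Nonempty β := by
  by_contra h
  rw [not_nonempty_iff] at h
  have := hQ.2
  simp at this

theorem FD_le_FM [Fintype α] [Fintype β] {P : α → ℝ} (hP : IsProb P) {Q : β → ℝ}
    (hQ : IsProb Q) : FD P Q ≤ FM P Q := by
  obtain ⟨y⟩ := hQ.nonempty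
  refine csSup_le ⟨_, fun _ => y, rfl⟩ ?_
  rintro _ ⟨W, rfl⟩
  exact le_csSup (bddAbove_FM P hQ) ⟨_, hP.push W, maj_push hP W, rfl⟩

theorem FM_le [Fintype α] [Fintype β] {P : α → ℝ} (hP : IsProb P) {Q : β → ℝ}
    (hQ : IsProb Q) {c : ℝ} (h : ∀ P' : β → ℝ, IsProb P' → Maj P P' → fid P' Q ≤ c) :
    FM P Q ≤ c := by
  obtain ⟨y⟩ := hQ.nonempty
  refine csSup_le ⟨_, _, hP.push fun _ => y, maj_push hP _, rfl⟩ ?_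
  rintro _ ⟨P', h1, h2, rfl⟩
  exact h P' h1 h2

/-- Greedy selection: a part of `T` of total mass at most `r`, and within `m` of it. -/
theorem exists_subset_sum_near {p : α → ℝ} {T : Finset α} {m r : ℝ} (hm : ∀ x ∈ T, p x ≤ m)
    (hr : 0 ≤ r) :
    ∃ A ⊆ T, ∑ x ∈ A, p x ≤ r ∧ (A = T ∨ r - m ≤ ∑ x ∈ A, p x) := by
  classical
  induction T using Finset.induction_on with
  | empty => exact ⟨∅, by simp, by simpa using hr, Or.inl rfl⟩
  | insert a T ha ih =>
    obtain ⟨A, hAT, hAr, hA⟩ := ih fun x hx => hm x (Finset.mem_insert_of_mem hx)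
    rcases hA with rfl | hA
    · by_cases h : ∑ x ∈ insert a A, p x ≤ r
      · exact ⟨_, subset_rfl, h, Or.inl rfl⟩
      · refine ⟨A, Finset.subset_insert _ _, hAr, Or.inr ?_⟩
        rw [Finset.sum_insert ha] at h
        have := hm a (Finset.mem_insert_self _ _)
        linarith
    · exact ⟨A, hAT.trans (Finset.subset_insert _ _), hAr, Or.inr hA⟩

/-- Bin filling: atoms of mass at most `m` fill bins of given capacities up to an error `m`. -/
theorem exists_binFilling [Nonempty β] [DecidableEq β] {p : α → ℝ} (hp : ∀ x, 0 ≤ p x) {m : ℝ}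
    (hm0 : 0 ≤ m) {R : β → ℝ} (hR : ∀ y, 0 ≤ R y) (S : Finset β) (T : Finset α)
    (hm : ∀ x ∈ T, p x ≤ m) (hle : ∑ y ∈ S, R y ≤ ∑ x ∈ T, p x) :
    ∃ W : α → β, ∀ y ∈ S, R y - m ≤ ∑ x ∈ T with W x = y, p x := by
  classical
  induction S using Finset.induction_on generalizing T with
  | empty => exact ⟨fun _ => Classical.arbitrary β, by simp⟩
  | insert a S ha ih =>
    rw [Finset.sum_insert ha] at hle
    obtain ⟨A, hAT, hAr, hA⟩ := exists_subset_sum_near hm (hR a)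
    have hS : 0 ≤ ∑ y ∈ S, R y := Finset.sum_nonneg fun y _ => hR y
    have hA' : R a - m ≤ ∑ x ∈ A, p x := by
      rcases hA with rfl | hA
      · linarith
      · exact hA
    have hsd := Finset.sum_sdiff (f := p) hAT
    obtain ⟨W, hW⟩ := ih (T \ A) (fun x hx => hm x (Finset.sdiff_subset hx)) (by linarith)
    refine ⟨fun x => if x ∈ A then a else W x, fun y hy => ?_⟩
    rcases Finset.mem_insert.1 hy with rfl | hy
    · refine hA'.trans (Finset.sum_le_sum_of_subset_of_nonneg (fun x hx => ?_) fun x _ _ => hp x)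
      simp [hx, hAT hx]
    · refine (hW y hy).trans
        (Finset.sum_le_sum_of_subset_of_nonneg (fun x hx => ?_) fun x _ _ => hp x)
      simp only [Finset.mem_filter, Finset.mem_sdiff] at hx ⊢
      simp [hx.1.1, hx.1.2, hx.2]

/-- A map sending the pieces `T i` to the pieces `S i` has a large fidelity provided that the
atoms of `T i` are small compared with those of `S i`. -/
theorem le_FD_of_pieces [Fintype α] [Fintype β] {p : α → ℝ} {q : β → ℝ} (hp : IsProb p)
    (hq : IsProb q) {ι : Type*} (I : Finset ι) (T : ι → Finset α) (S : ι → Finset β)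
    (hT : (I : Set ι).PairwiseDisjoint T) (hS : (I : Set ι).PairwiseDisjoint S)
    (m : ι → ℝ) (hm : ∀ i ∈ I, ∀ x ∈ T i, p x ≤ m i) (hm0 : ∀ i ∈ I, 0 ≤ m i)
    {ε : ℝ} (hε : ε ≤ 1)
    (hsmall : ∀ i ∈ I, ∀ y ∈ S i, m i * ∑ z ∈ S i, q z ≤ ε * (q y * ∑ x ∈ T i, p x)) :
    Real.sqrt (1 - ε) * ∑ i ∈ I, Real.sqrt ((∑ x ∈ T i, p x) * ∑ y ∈ S i, q y) ≤ FD p q := by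
  classical
  have : Nonempty β := hq.nonempty
  have hTn : ∀ i, 0 ≤ ∑ x ∈ T i, p x := fun i => Finset.sum_nonneg fun x _ => hp.1 x
  have hSn : ∀ i, 0 ≤ ∑ y ∈ S i, q y := fun i => Finset.sum_nonneg fun x _ => hq.1 x
  have key : ∀ i : ι, ∃ W : α → β, i ∈ I → ∀ y ∈ S i,
      (∑ x ∈ T i, p x) * q y / (∑ z ∈ S i, q z) - m i ≤ ∑ x ∈ T i with W x = y, p x := by
    intro i
    by_cases hi : i ∈ I
    · obtain ⟨W, hW⟩ := exists_binFilling hp.1 (hm0 i hi)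
        (R := fun y => (∑ x ∈ T i, p x) * q y / (∑ z ∈ S i, q z))
        (fun y => div_nonneg (mul_nonneg (hTn i) (hq.1 y)) (hSn i)) (S i) (T i) (hm i hi) (by
          rw [← Finset.sum_div, ← Finset.mul_sum]
          rcases (hSn i).eq_or_lt with h | h
          · rw [← h]; simpa using hTn i
          · rw [mul_div_assoc, div_self h.ne', mul_one])
      exact ⟨W, fun _ => hW⟩
    · exact ⟨fun _ => Classical.arbitrary β, fun h => absurd h hi⟩
  choose Wi hWi using key
  let W : α → β := fun x => if h : ∃ i ∈ I, x ∈ T i then Wi h.choose x else Classical.arbitrary β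
  have hW : ∀ i ∈ I, ∀ x ∈ T i, W x = Wi i x := by
    intro i hi x hx
    have h : ∃ i ∈ I, x ∈ T i := ⟨i, hi, hx⟩
    have hj : h.choose = i := by
      by_contra hne
      exact Finset.disjoint_left.1 (hT h.choose_spec.1 hi hne) h.choose_spec.2 hx
    simp only [W, dif_pos h, hj]
  have hpush : ∀ i ∈ I, ∀ y ∈ S i,
      (∑ x ∈ T i, p x) * q y / (∑ z ∈ S i, q z) - m i ≤ push W p y := by
    intro i hi y hy
    refine (hWi i hi y hy).trans ?_
    rw [push_eq_sum_filter]
    refine Finset.sum_le_sum_of_subset_of_nonneg (fun x hx => ?_) fun x _ _ => hp.1 x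
    simp only [Finset.mem_filter, Finset.mem_univ, true_and] at hx ⊢
    rw [hW i hi x hx.1, hx.2]
  refine le_trans ?_ (le_csSup (bddAbove_FD hp hq) ⟨W, rfl⟩)
  have hpiece : ∀ i ∈ I, Real.sqrt (1 - ε) * Real.sqrt ((∑ x ∈ T i, p x) * ∑ y ∈ S i, q y)
      ≤ ∑ y ∈ S i, Real.sqrt (push W p y * q y) := by
    intro i hi
    rcases (hSn i).eq_or_lt with h | h
    · rw [← h]; simpa using Finset.sum_nonneg fun y _ => Real.sqrt_nonneg _
    have h2 : ∀ y ∈ S i, Real.sqrt (1 - ε) *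
        (Real.sqrt ((∑ x ∈ T i, p x) / ∑ y ∈ S i, q y) * q y) ≤ Real.sqrt (push W p y * q y) := by
      intro y hy
      refine Real.le_sqrt_of_sq_le ?_
      rw [mul_pow, mul_pow, Real.sq_sqrt (by linarith), Real.sq_sqrt (div_nonneg (hTn i) h.le)]
      have h3 := hpush i hi y hy
      have h4 : m i ≤ ε * ((∑ x ∈ T i, p x) * q y / (∑ z ∈ S i, q z)) := by
        rw [mul_div_assoc', le_div_iff₀ h]
        calc _ ≤ _ := hsmall i hi y hy
          _ = _ := by ring
      calc (1 - ε) * ((∑ x ∈ T i, p x) / (∑ y ∈ S i, q y) * q y ^ 2)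
          = ((1 - ε) * ((∑ x ∈ T i, p x) * q y / (∑ z ∈ S i, q z))) * q y := by ring
        _ ≤ _ := mul_le_mul_of_nonneg_right (by linarith) (hq.1 y)
    refine le_trans (le_of_eq ?_) (Finset.sum_le_sum h2)
    rw [← Finset.mul_sum, ← Finset.mul_sum]
    congr 1
    rw [Real.sqrt_div (hTn i), Real.sqrt_mul (hTn i)]
    field_simp
    rw [Real.sq_sqrt h.le]
  rw [Finset.mul_sum]
  refine (Finset.sum_le_sum hpiece).trans ?_
  rw [← Finset.sum_biUnion hS]
  exact Finset.sum_le_sum_of_subset_of_nonneg (Finset.subset_univ _) fun _ _ _ => Real.sqrt_nonneg _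

theorem exists_perm_monovary [Fintype β] (R Q : β → ℝ) :
    ∃ σ : Equiv.Perm β, Monovary (R ∘ σ) Q := by
  let e := Fintype.equivFin β
  let u : Fin (Fintype.card β) → ℝ := R ∘ e.symm
  let v : Fin (Fintype.card β) → ℝ := Q ∘ e.symm
  have hu := Tuple.monotone_sort u
  have hv := Tuple.monotone_sort v
  refine ⟨(e.trans ((Tuple.sort v).symm.trans (Tuple.sort u))).trans e.symm, fun i j hij => ?_⟩
  have key : ∀ k, Q k = (v ∘ Tuple.sort v) ((Tuple.sort v).symm (e k)) := fun k => by simp [v]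
  have key' : ∀ k, (R ∘ ((e.trans ((Tuple.sort v).symm.trans (Tuple.sort u))).trans e.symm)) k =
      (u ∘ Tuple.sort u) ((Tuple.sort v).symm (e k)) := fun k => by simp [u]
  rw [key', key']
  apply hu
  by_contra hlt
  rw [key, key] at hij
  exact absurd (hv (not_le.1 hlt).le) (not_le.2 hij)

theorem fid_le_fid_of_monovary [Fintype β] {R Q : β → ℝ} (hR : ∀ y, 0 ≤ R y) (σ : Equiv.Perm β)
    (h : Monovary (R ∘ σ) Q) : fid R Q ≤ fid (R ∘ σ) Q := by
  have hm : Monovary (fun y => √(R (σ y))) fun y => √(Q y) := fun i j hij =>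
    Real.sqrt_le_sqrt (h (lt_of_not_ge fun hle => hij.not_ge (Real.sqrt_le_sqrt hle)))
  have := hm.sum_comp_perm_mul_le_sum_mul (σ := σ⁻¹)
  simpa [fid, Real.sqrt_mul, hR] using this

theorem topSum_comp_perm [Fintype β] (R : β → ℝ) (σ : Equiv.Perm β) (l : ℕ) :
    topSum R l ≤ topSum (R ∘ σ) l := by
  classical
  refine topSum_le fun A hA => ?_
  have := sum_le_topSum (R ∘ σ) (l := l) (A := A.map σ.symm.toEmbedding) (by simpa using hA)
  simpa using this

open Classical in
/-- The outcomes of probability at least `exp (-s)`. -/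
noncomputable def upSet [Fintype α] (P : α → ℝ) (s : ℝ) : Finset α :=
  Finset.univ.filter fun x => Real.exp (-s) ≤ P x

/-- The probability of the outcomes of probability at least `exp (-s)`. -/
noncomputable def upMass [Fintype α] (P : α → ℝ) (s : ℝ) : ℝ := ∑ x ∈ upSet P s, P x

theorem mem_upSet [Fintype α] {P : α → ℝ} {s : ℝ} {x : α} :
    x ∈ upSet P s ↔ Real.exp (-s) ≤ P x := by simp [upSet]

theorem upSet_mono [Fintype α] (P : α → ℝ) : Monotone (upSet P) := fun s t h x hx => by
  rw [mem_upSet] at *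
  exact (Real.exp_le_exp.2 (by linarith)).trans hx

theorem upMass_mono [Fintype α] (P : α → ℝ) : Monotone (upMass P) := fun _ _ h =>
  Finset.sum_le_sum_of_subset_of_nonneg (upSet_mono P h) fun _ hx _ =>
    (Real.exp_pos _).le.trans (mem_upSet.1 hx)

theorem upMass_nonneg [Fintype α] (P : α → ℝ) (s : ℝ) : 0 ≤ upMass P s :=
  Finset.sum_nonneg fun _ hx => (Real.exp_pos _).le.trans (mem_upSet.1 hx)

theorem upMass_le_one [Fintype α] {P : α → ℝ} (hP : IsProb P) (s : ℝ) : upMass P s ≤ 1 := by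
  rw [← hP.2]
  exact Finset.sum_le_sum_of_subset_of_nonneg (Finset.subset_univ _) fun x _ _ => hP.1 x

theorem upMass_le_topSum [Fintype α] (P : α → ℝ) {s : ℝ} {l : ℕ} (h : (upSet P s).card ≤ l) :
    upMass P s ≤ topSum P l :=
  sum_le_topSum P h

theorem topSum_card_upSet_le [Fintype β] {R Q : β → ℝ} (hR : ∀ y, 0 ≤ R y) (h : Monovary R Q)
    (s : ℝ) : topSum R (upSet Q s).card ≤ ∑ y ∈ upSet Q s, R y := by
  classical
  refine topSum_le fun A hA => ?_
  set U := upSet Q s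
  rw [← Finset.sum_sdiff (Finset.inter_subset_left : A ∩ U ⊆ A),
    ← Finset.sum_sdiff (Finset.inter_subset_right : A ∩ U ⊆ U)]
  gcongr ?_ + _
  have hcard : (A \ (A ∩ U)).card ≤ (U \ (A ∩ U)).card := by
    rw [Finset.card_sdiff_of_subset Finset.inter_subset_left,
      Finset.card_sdiff_of_subset Finset.inter_subset_right]
    omega
  rcases (A \ (A ∩ U)).eq_empty_or_nonempty with he | hne
  · rw [he, Finset.sum_empty]
    exact Finset.sum_nonneg fun y _ => hR y
  obtain ⟨a, ha, hmax⟩ := Finset.exists_max_image _ R hne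
  have haU : a ∉ U := by
    simp only [Finset.mem_sdiff, Finset.mem_inter, not_and] at ha
    exact ha.2 ha.1
  calc ∑ x ∈ A \ (A ∩ U), R x ≤ (A \ (A ∩ U)).card • R a := Finset.sum_le_card_nsmul _ _ _ hmax
    _ ≤ (U \ (A ∩ U)).card • R a := nsmul_le_nsmul_left (hR a) hcard
    _ ≤ _ := Finset.card_nsmul_le_sum _ _ _ fun y hy => by
      apply h
      have hy' : y ∈ U := (Finset.mem_sdiff.1 hy).1
      rw [mem_upSet] at hy' haU
      linarith

/-- The number of outcomes of probability at least `exp (-s)` is at most `exp s`. -/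
theorem card_upSet_le [Fintype α] {P : α → ℝ} (hP : IsProb P) (s : ℝ) :
    ((upSet P s).card : ℝ) ≤ Real.exp s := by
  have h : ((upSet P s).card : ℝ) * Real.exp (-s) ≤ 1 := by
    refine le_trans ?_ (upMass_le_one hP s)
    rw [← nsmul_eq_mul]
    exact Finset.card_nsmul_le_sum _ _ _ fun x hx => mem_upSet.1 hx
  rwa [Real.exp_neg, ← div_eq_mul_inv, div_le_one (Real.exp_pos s)] at h

theorem le_card_upSet [Fintype α] (P : α → ℝ) {s t : ℝ} (hst : s ≤ t) :
    (upMass P t - upMass P s) * Real.exp s ≤ (upSet P t).card := by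
  classical
  have h : upMass P t - upMass P s ≤ (upSet P t).card * Real.exp (-s) := by
    unfold upMass
    rw [← Finset.sum_sdiff (upSet_mono P hst), add_sub_cancel_right]
    calc _ ≤ (upSet P t \ upSet P s).card • Real.exp (-s) :=
          Finset.sum_le_card_nsmul _ _ _ fun x hx => by
            simp only [Finset.mem_sdiff, mem_upSet] at hx
            exact (not_le.1 hx.2).le
      _ ≤ _ := by
        rw [nsmul_eq_mul]
        gcongr
        exact Finset.sdiff_subset
  rwa [Real.exp_neg, ← div_eq_mul_inv, le_div_iff₀ (Real.exp_pos s)] at h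

theorem integral_mul_step {a M z : ℝ} (hz : z ∈ Set.Icc a M) {g χ : ℝ → ℝ}
    (hg : ContinuousOn g (Set.Icc a M)) (h1 : ∀ t ∈ Set.Ioo a M, t < z → χ t = 1)
    (h0 : ∀ t ∈ Set.Ioo a M, z < t → χ t = 0) :
    IntervalIntegrable (fun t => g t * χ t) volume a M ∧
      ∫ t in a..M, g t * χ t = ∫ t in a..z, g t := by
  have hgi : IntervalIntegrable g volume a z :=
    ContinuousOn.intervalIntegrable_of_Icc hz.1 (hg.mono (Set.Icc_subset_Icc_right hz.2))
  have hA : ∀ t ∈ Set.Ioo a z, g t = g t * χ t := fun t ht => by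
    rw [h1 t ⟨ht.1, ht.2.trans_le hz.2⟩ ht.2, mul_one]
  have hB : ∀ t ∈ Set.Ioo z M, (0 : ℝ) = g t * χ t := fun t ht => by
    rw [h0 t ⟨hz.1.trans_lt ht.1, ht.2⟩ ht.1, mul_zero]
  have iA : IntervalIntegrable (fun t => g t * χ t) volume a z := by
    refine hgi.congr_uIoo ?_
    rw [Set.uIoo_of_le hz.1]
    exact hA
  have iB : IntervalIntegrable (fun t => g t * χ t) volume z M := by
    refine (intervalIntegrable_const (c := (0 : ℝ))).congr_uIoo ?_
    rw [Set.uIoo_of_le hz.2]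
    exact hB
  refine ⟨iA.trans iB, ?_⟩
  rw [← intervalIntegral.integral_add_adjacent_intervals iA iB,
    ← intervalIntegral.integral_congr_Ioo_of_le hz.1 hA,
    ← intervalIntegral.integral_congr_Ioo_of_le hz.2 hB]
  simp

theorem antitone_one_sub_topSum [Fintype α] [Fintype β] (p : α → ℝ) (q : β → ℝ) (c : ℝ) {s : ℝ}
    (hs : 0 < s) : Antitone fun t => 1 - topSum p (upSet q (c + t * s)).card := fun t t' h => by
  have : (upSet q (c + t * s)).card ≤ (upSet q (c + t' * s)).card :=
    Finset.card_le_card (upSet_mono q (by gcongr))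
  exact sub_le_sub_left (topSum_mono p this) 1

theorem antitone_one_sub_upMass [Fintype β] (q : β → ℝ) (c : ℝ) {s : ℝ}
    (hs : 0 < s) : Antitone fun t => 1 - upMass q (c + t * s) := fun t t' h => by
  have : upMass q (c + t * s) ≤ upMass q (c + t' * s) := upMass_mono q (by gcongr)
  exact sub_le_sub_left this 1

/-- The location in `[a, M]` at which `y` enters the sets `upSet q (c + t * s)`. -/
theorem exists_entry [Fintype β] {q : β → ℝ} (hq : ∀ y, 0 ≤ q y) (c : ℝ) {s a M : ℝ} (hs : 0 < s)
    (haM : a ≤ M) (y : β) : ∃ z ∈ Set.Icc a M, (∀ t ∈ Set.Ioo a M, t < z → y ∉ upSet q (c + t * s)) ∧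
      ∀ t ∈ Set.Ioo a M, z < t → y ∈ upSet q (c + t * s) := by
  rcases (hq y).eq_or_lt with h | h
  · refine ⟨M, ⟨haM, le_rfl⟩, fun t _ _ => ?_, fun t ht hz => absurd ht.2 hz.not_gt⟩
    rw [mem_upSet, ← h, not_le]
    exact Real.exp_pos _
  · set w := (-Real.log (q y) - c) / s with hw
    have key : ∀ t, y ∈ upSet q (c + t * s) ↔ w ≤ t := fun t => by
      rw [mem_upSet, ← Real.le_log_iff_exp_le h, hw, div_le_iff₀ hs]
      constructor <;> intro h <;> linarith
    refine ⟨max a (min w M), ⟨le_max_left _ _, max_le haM (min_le_right _ _)⟩, ?_, ?_⟩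
    · intro t ht hz
      rw [key, not_le]
      rcases lt_max_iff.1 hz with h1 | h1
      · exact absurd ht.1 h1.not_gt
      · exact (lt_min_iff.1 h1).1
    · intro t ht hz
      rw [key]
      rcases min_lt_iff.1 (max_lt_iff.1 hz).2 with h1 | h1
      · exact h1.le
      · exact absurd ht.2 h1.not_gt

theorem fid_le_of_maj_aux [Fintype β] {q R : β → ℝ} (hq : IsProb q)
    (hR : IsProb R) (c : ℝ) {s a M : ℝ} (hs : 0 < s) (haM : a ≤ M)
    {f f' : ℝ → ℝ} (hf : ∀ t ∈ Set.Icc a M, HasDerivAt f (f' t) t)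
    (hf' : ContinuousOn f' (Set.Icc a M)) (hf0 : ∀ t ∈ Set.Icc a M, 0 < f t) :
    2 * fid R q ≤
      (f a + ∫ t in a..M, f' t * (1 - ∑ y ∈ upSet q (c + t * s), R y)) +
      (1 / f a + ∫ t in a..M, -f' t / f t ^ 2 * (1 - upMass q (c + t * s))) := by
  classical
  let χ : β → ℝ → ℝ := fun y t => if y ∈ upSet q (c + t * s) then 0 else 1
  choose z hz hz1 hz0 using exists_entry hq.1 c hs haM
  have hχ1 : ∀ y, ∀ t ∈ Set.Ioo a M, t < z y → χ y t = 1 := fun y t ht h => by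
    simp [χ, hz1 y t ht h]
  have hχ0 : ∀ y, ∀ t ∈ Set.Ioo a M, z y < t → χ y t = 0 := fun y t ht h => by
    simp [χ, hz0 y t ht h]
  have hfc : ContinuousOn f (Set.Icc a M) := fun t ht => (hf t ht).continuousAt.continuousWithinAt
  have hg' : ContinuousOn (fun t => -f' t / f t ^ 2) (Set.Icc a M) :=
    hf'.neg.div (hfc.pow 2) fun t ht => (pow_pos (hf0 t ht) 2).ne'
  have hg : ∀ t ∈ Set.Icc a M, HasDerivAt (fun t => 1 / f t) (-f' t / f t ^ 2) t := fun t ht => by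
    simpa only [one_div] using (hf t ht).fun_inv (hf0 t ht).ne'
  have layer : ∀ {h h' : ℝ → ℝ}, (∀ t ∈ Set.Icc a M, HasDerivAt h (h' t) t) →
      ContinuousOn h' (Set.Icc a M) → ∀ S : β → ℝ, ∑ y, S y = 1 →
      ∑ y, S y * h (z y) = h a + ∫ t in a..M, h' t * (1 - ∑ y ∈ upSet q (c + t * s), S y) := by
    intro h h' hd hc S hS
    have h1 : ∀ y, h (z y) = h a + ∫ t in a..M, h' t * χ y t := fun y => by
      rw [(integral_mul_step (hz y) hc (hχ1 y) (hχ0 y)).2,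
        intervalIntegral.integral_eq_sub_of_hasDerivAt (f := h)]
      · ring
      · intro t ht
        rw [Set.uIcc_of_le (hz y).1] at ht
        exact hd t (Set.Icc_subset_Icc_right (hz y).2 ht)
      · exact ContinuousOn.intervalIntegrable_of_Icc (hz y).1
          (hc.mono (Set.Icc_subset_Icc_right (hz y).2))
    have h2 : ∀ t, h' t * (1 - ∑ y ∈ upSet q (c + t * s), S y) = ∑ y, S y * (h' t * χ y t) := by
      intro t
      have : 1 - ∑ y ∈ upSet q (c + t * s), S y = ∑ y, S y * χ y t := by
        rw [← hS, ← Finset.sum_sdiff (Finset.subset_univ (upSet q (c + t * s))),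
          add_sub_cancel_right, ← Finset.sum_sdiff (Finset.subset_univ (upSet q (c + t * s)))
            (f := fun y => S y * χ y t)]
        have e1 : ∑ y ∈ upSet q (c + t * s), S y * χ y t = 0 :=
          Finset.sum_eq_zero fun y hy => by simp [χ, hy]
        rw [e1, add_zero]
        refine Finset.sum_congr rfl fun y hy => ?_
        simp [χ, (Finset.mem_sdiff.1 hy).2]
      rw [this, Finset.mul_sum]
      exact Finset.sum_congr rfl fun y _ => by ring
    simp_rw [h2]
    rw [intervalIntegral.integral_finsetSum fun y _ =>
      (integral_mul_step (hz y) hc (hχ1 y) (hχ0 y)).1.const_mul _]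
    simp_rw [intervalIntegral.integral_const_mul, h1, mul_add, Finset.sum_add_distrib,
      ← Finset.sum_mul, hS, one_mul]
  have e1 := layer hf hf' R hR.2
  have e2 := layer hg hg' q hq.2
  unfold upMass
  rw [← e1, ← e2, ← Finset.sum_add_distrib, fid, Finset.mul_sum]
  refine Finset.sum_le_sum fun y _ => ?_
  have hpos := hf0 (z y) (hz y)
  have hR' := hR.1 y
  have hq' := hq.1 y
  have : √(R y * q y) = √(R y * f (z y)) * √(q y * (1 / f (z y))) := by
    rw [← Real.sqrt_mul (by positivity)]
    congr 1
    field_simp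
  rw [this]
  have s1 := Real.sq_sqrt (show 0 ≤ R y * f (z y) by positivity)
  have s2 := Real.sq_sqrt (show 0 ≤ q y * (1 / f (z y)) by positivity)
  nlinarith [sq_nonneg (√(R y * f (z y)) - √(q y * (1 / f (z y))))]

theorem fid_le_of_maj [Fintype α] [Fintype β] {p : α → ℝ} {q R : β → ℝ}
    (hq : IsProb q) (hR : IsProb R) (hmaj : Maj p R) (c : ℝ) {s a M : ℝ} (hs : 0 < s) (haM : a ≤ M)
    {f f' : ℝ → ℝ} (hf : ∀ t ∈ Set.Icc a M, HasDerivAt f (f' t) t)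
    (hf' : ContinuousOn f' (Set.Icc a M)) (hf0 : ∀ t ∈ Set.Icc a M, 0 < f t)
    (hnn : ∀ t ∈ Set.Icc a M, 0 ≤ f' t) :
    2 * fid R q ≤
      (f a + ∫ t in a..M, f' t * (1 - topSum p (upSet q (c + t * s)).card)) +
      (1 / f a + ∫ t in a..M, -f' t / f t ^ 2 * (1 - upMass q (c + t * s))) := by
  obtain ⟨σ, hσ⟩ := exists_perm_monovary R q
  have hRσ : IsProb (R ∘ σ) := ⟨fun y => hR.1 _, by
    rw [← hR.2]; exact Equiv.sum_comp σ R⟩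
  have h1 := fid_le_fid_of_monovary hR.1 σ hσ
  have h2 := fid_le_of_maj_aux hq hRσ c hs haM hf hf' hf0
  have hIf' : IntervalIntegrable f' volume a M := ContinuousOn.intervalIntegrable_of_Icc haM hf'
  have hmono : Antitone fun t => 1 - ∑ y ∈ upSet q (c + t * s), (R ∘ σ) y := fun t t' h => by
    have : ∑ y ∈ upSet q (c + t * s), (R ∘ σ) y ≤ ∑ y ∈ upSet q (c + t' * s), (R ∘ σ) y :=
      Finset.sum_le_sum_of_subset_of_nonneg (upSet_mono q (by gcongr)) fun y _ _ => hRσ.1 y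
    exact sub_le_sub_left this 1
  have h3 : ∫ t in a..M, f' t * (1 - ∑ y ∈ upSet q (c + t * s), (R ∘ σ) y) ≤
      ∫ t in a..M, f' t * (1 - topSum p (upSet q (c + t * s)).card) := by
    refine intervalIntegral.integral_mono_on haM ?_ ?_ fun t ht => ?_
    · exact hmono.intervalIntegrable.continuousOn_mul (by rwa [Set.uIcc_of_le haM])
    · exact (antitone_one_sub_topSum p q c hs).intervalIntegrable.continuousOn_mul
        (by rwa [Set.uIcc_of_le haM])
    · refine mul_le_mul_of_nonneg_left ?_ (hnn t ht)
      have := (hmaj _).trans ((topSum_comp_perm R σ _).trans (topSum_card_upSet_le hRσ.1 hσ (c + t * s)))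
      linarith
  linarith

open Classical in
theorem sum_upSet_sdiff {X : Type*} [Fintype X] (r : X → ℝ) {x y : ℝ} (h : x ≤ y) :
    ∑ z ∈ upSet r y \ upSet r x, r z = upMass r y - upMass r x := by
  unfold upMass
  rw [← Finset.sum_sdiff (upSet_mono r h), add_sub_cancel_right]

open Classical in
theorem pairwiseDisjoint_upSet_sdiff {X : Type*} [Fintype X] (r : X → ℝ) {g : ℕ → ℝ}
    (hg : Monotone g) (I : Set ℕ) :
    I.PairwiseDisjoint fun i => upSet r (g (i + 1)) \ upSet r (g i) := by
  have key : ∀ i j, i < j → Disjoint (upSet r (g (i + 1)) \ upSet r (g i))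
      (upSet r (g (j + 1)) \ upSet r (g j)) := fun i j hij =>
    Finset.disjoint_left.2 fun x hx hx' =>
      (Finset.mem_sdiff.1 hx').2 (upSet_mono r (hg hij) (Finset.mem_sdiff.1 hx).1)
  intro i _ j _ hij
  rcases lt_or_gt_of_ne hij with h | h
  · exact key i j h
  · exact (key j i h).symm

section Asymptotics

variable {A B : ℕ → Type*} [∀ n, Fintype (A n)] [∀ n, Fintype (B n)]
  {p : ∀ n, A n → ℝ} {q : ∀ n, B n → ℝ} {c s : ℕ → ℝ} {F₁ F₂ : ℝ → ℝ}

theorem eventually_le_topSum (hp : ∀ n, IsProb (p n))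
    (hs : Tendsto s atTop atTop)
    (h₁ : ∀ t, Tendsto (fun n => upMass (p n) (c n + t * s n)) atTop (nhds (F₁ t)))
    (h₂ : ∀ t, Tendsto (fun n => upMass (q n) (c n + t * s n)) atTop (nhds (F₂ t)))
    (hF₁ : Continuous F₁) (hF₂ : StrictMono F₂) (t : ℝ) {ε : ℝ} (hε : 0 < ε) :
    ∀ᶠ n in atTop, F₁ t - ε < topSum (p n) (upSet (q n) (c n + t * s n)).card := by
  obtain ⟨δ, hδ, hδF⟩ : ∃ δ > 0, F₁ t - ε < F₁ (t - δ) := by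
    have h : Tendsto (fun δ : ℝ => F₁ (t - δ)) (nhdsWithin 0 (Set.Ioi 0)) (nhds (F₁ t)) := by
      have : Tendsto (fun δ : ℝ => F₁ (t - δ)) (nhds 0) (nhds (F₁ (t - 0))) :=
        (by fun_prop : Continuous fun δ : ℝ => F₁ (t - δ)).tendsto 0
      rw [sub_zero] at this
      exact this.mono_left nhdsWithin_le_nhds
    obtain ⟨δ, h1, h2⟩ := ((h.eventually_const_lt (sub_lt_self (F₁ t) hε)).and self_mem_nhdsWithin).exists
    exact ⟨δ, h2, h1⟩
  have hη : 0 < F₂ t - F₂ (t - δ / 2) := sub_pos.2 (hF₂ (by linarith))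
  have e1 := (h₁ (t - δ)).eventually_const_lt hδF
  have e2 := ((h₂ t).sub (h₂ (t - δ / 2))).eventually_const_lt (half_lt_self hη)
  have e3 : ∀ᶠ n in atTop, 1 ≤ (F₂ t - F₂ (t - δ / 2)) / 2 * Real.exp (δ / 2 * s n) :=
    ((Real.tendsto_exp_atTop.comp (hs.const_mul_atTop (half_pos hδ))).const_mul_atTop
      (half_pos hη)).eventually_ge_atTop 1
  filter_upwards [e1, e2, e3, hs.eventually_gt_atTop 0] with n e1 e2 e3 hsn
  refine e1.trans_le (upMass_le_topSum _ ?_)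
  have k1 := card_upSet_le (hp n) (c n + (t - δ) * s n)
  have k2 := le_card_upSet (q n) (s := c n + (t - δ / 2) * s n) (t := c n + t * s n)
    (by nlinarith)
  have k3 : Real.exp (c n + (t - δ / 2) * s n) =
      Real.exp (δ / 2 * s n) * Real.exp (c n + (t - δ) * s n) := by
    rw [← Real.exp_add]; congr 1; ring
  have : ((upSet (p n) (c n + (t - δ) * s n)).card : ℝ) ≤ (upSet (q n) (c n + t * s n)).card := by
    calc _ ≤ Real.exp (c n + (t - δ) * s n) := k1
      _ ≤ ((F₂ t - F₂ (t - δ / 2)) / 2 * Real.exp (δ / 2 * s n)) *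
          Real.exp (c n + (t - δ) * s n) := le_mul_of_one_le_left (Real.exp_pos _).le e3
      _ = (F₂ t - F₂ (t - δ / 2)) / 2 * Real.exp (c n + (t - δ / 2) * s n) := by rw [k3]; ring
      _ ≤ _ := mul_le_mul_of_nonneg_right e2.le (Real.exp_pos _).le
      _ ≤ _ := k2
  exact_mod_cast this

theorem eventually_FM_le (hp : ∀ n, IsProb (p n)) (hq : ∀ n, IsProb (q n))
    (hs : Tendsto s atTop atTop)
    (h₁ : ∀ t, Tendsto (fun n => upMass (p n) (c n + t * s n)) atTop (nhds (F₁ t)))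
    (h₂ : ∀ t, Tendsto (fun n => upMass (q n) (c n + t * s n)) atTop (nhds (F₂ t)))
    (hF₁ : Continuous F₁) (hF₂ : StrictMono F₂) {a M : ℝ} (haM : a ≤ M)
    {f f' : ℝ → ℝ} (hf : ∀ t ∈ Set.Icc a M, HasDerivAt f (f' t) t)
    (hf' : ContinuousOn f' (Set.Icc a M)) (hf0 : ∀ t ∈ Set.Icc a M, 0 < f t)
    (hnn : ∀ t ∈ Set.Icc a M, 0 ≤ f' t) {v : ℝ}
    (hv : (f a + ∫ t in a..M, f' t * (1 - F₁ t)) +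
      (1 / f a + ∫ t in a..M, -f' t / f t ^ 2 * (1 - F₂ t)) < 2 * v) :
    ∀ᶠ n in atTop, FM (p n) (q n) ≤ v := by
  have hF₁0 : ∀ t, 0 ≤ F₁ t := fun t => ge_of_tendsto' (h₁ t) fun n => upMass_nonneg _ _
  have hfc : ContinuousOn f (Set.Icc a M) := fun t ht => (hf t ht).continuousAt.continuousWithinAt
  have hg' : ContinuousOn (fun t => -f' t / f t ^ 2) (Set.Icc a M) :=
    hf'.neg.div (hfc.pow 2) fun t ht => (pow_pos (hf0 t ht) 2).ne'
  have dct : ∀ {h : ℝ → ℝ} {G : ℕ → ℝ → ℝ} {G₀ : ℝ → ℝ}, ContinuousOn h (Set.Icc a M) →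
      (∀ᶠ n in atTop, Measurable (G n)) → (∀ n t, |G n t| ≤ 1) →
      (∀ t, Tendsto (fun n => G n t) atTop (nhds (G₀ t))) →
      Tendsto (fun n => ∫ t in a..M, h t * G n t) atTop (nhds (∫ t in a..M, h t * G₀ t)) := by
    intro h G G₀ hh hm hb hlim
    refine intervalIntegral.tendsto_integral_filter_of_dominated_convergence (fun t => |h t|)
      ?_ ?_ ?_ ?_
    · filter_upwards [hm] with n hn
      rw [Set.uIoc_of_le haM]
      exact ((hh.mono Set.Ioc_subset_Icc_self).aestronglyMeasurable measurableSet_Ioc).mul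
        hn.aestronglyMeasurable
    · refine Eventually.of_forall fun n => ae_of_all _ fun t _ => ?_
      rw [Real.norm_eq_abs, abs_mul]
      exact mul_le_of_le_one_right (abs_nonneg _) (hb n t)
    · exact (ContinuousOn.intervalIntegrable_of_Icc haM hh).abs
    · exact ae_of_all _ fun t _ => (hlim t).const_mul _
  have hs0 := hs.eventually_gt_atTop 0
  have hF₁1 : ∀ t, F₁ t ≤ 1 := fun t => le_of_tendsto' (h₁ t) fun n => upMass_le_one (hp n) _
  have d1 := dct (G := fun n t => max (1 - topSum (p n) (upSet (q n) (c n + t * s n)).card)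
      (1 - F₁ t)) (G₀ := fun t => 1 - F₁ t) hf'
    (hs0.mono fun n hn => (antitone_one_sub_topSum (p n) (q n) (c n) hn).measurable.max
      (by fun_prop))
    (fun n t => by
      have := topSum_nonneg (p n) (upSet (q n) (c n + t * s n)).card
      have := hF₁0 t
      have := hF₁1 t
      rw [abs_of_nonneg (le_max_of_le_right (by linarith))]
      exact max_le (by linarith) (by linarith))
    (fun t => by
      rw [tendsto_order]
      refine ⟨fun x hx => Eventually.of_forall fun n => lt_max_of_lt_right hx, fun x hx => ?_⟩
      filter_upwards [eventually_le_topSum hp hs h₁ h₂ hF₁ hF₂ t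
        (show 0 < x - (1 - F₁ t) by linarith)] with n hn
      exact max_lt (by linarith) hx)
  have d2 := dct (G := fun n t => 1 - upMass (q n) (c n + t * s n)) (G₀ := fun t => 1 - F₂ t) hg'
    (hs0.mono fun n hn => (antitone_one_sub_upMass (q n) (c n) hn).measurable)
    (fun n t => by
      have := upMass_nonneg (q n) (c n + t * s n)
      have := upMass_le_one (hq n) (c n + t * s n)
      rw [abs_le]
      constructor <;> linarith)
    (fun t => (h₂ t).const_sub _)
  have d := ((d1.const_add (f a)).add (d2.const_add (1 / f a))).eventually_lt_const hv
  filter_upwards [d, hs0] with n hn hsn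
  refine FM_le (hp n) (hq n) fun R hR hmaj => ?_
  have k := fid_le_of_maj (hq n) hR hmaj (c n) hsn haM hf hf' hf0 hnn
  have k2 : ∫ t in a..M, f' t * (1 - topSum (p n) (upSet (q n) (c n + t * s n)).card) ≤
      ∫ t in a..M, f' t * max (1 - topSum (p n) (upSet (q n) (c n + t * s n)).card)
        (1 - F₁ t) := by
    refine intervalIntegral.integral_mono_on haM ?_ ?_ fun t ht =>
      mul_le_mul_of_nonneg_left (le_max_left _ _) (hnn t ht)
    · exact (antitone_one_sub_topSum (p n) (q n) (c n) hsn).intervalIntegrable.continuousOn_mul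
        (by rwa [Set.uIcc_of_le haM])
    · have : IntervalIntegrable (fun t => max (1 - topSum (p n) (upSet (q n) (c n + t * s n)).card)
          (1 - F₁ t)) volume a M :=
        ⟨(antitone_one_sub_topSum (p n) (q n) (c n) hsn).intervalIntegrable.1.sup
          ((by fun_prop : Continuous fun t => 1 - F₁ t).intervalIntegrable a M).1,
        (antitone_one_sub_topSum (p n) (q n) (c n) hsn).intervalIntegrable.2.sup
          ((by fun_prop : Continuous fun t => 1 - F₁ t).intervalIntegrable a M).2⟩
      exact this.continuousOn_mul (by rwa [Set.uIcc_of_le haM])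
  linarith

theorem eventually_le_FD (hp : ∀ n, IsProb (p n)) (hq : ∀ n, IsProb (q n))
    (hs : Tendsto s atTop atTop)
    (h₁ : ∀ t, Tendsto (fun n => upMass (p n) (c n + t * s n)) atTop (nhds (F₁ t)))
    (h₂ : ∀ t, Tendsto (fun n => upMass (q n) (c n + t * s n)) atTop (nhds (F₂ t)))
    (hF₁ : StrictMono F₁) (k : ℕ) {σ τ : ℕ → ℝ} (hσ : Monotone σ) (hτ : StrictMono τ)
    (hστ : ∀ i, σ (i + 1) < τ i) {v : ℝ}
    (hv : v < ∑ i ∈ Finset.range k,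
      √((F₁ (τ (i + 1)) - F₁ (τ i)) * (F₂ (σ (i + 1)) - F₂ (σ i)))) :
    ∀ᶠ n in atTop, v ≤ FD (p n) (q n) := by
  classical
  set S := ∑ i ∈ Finset.range k,
      √((F₁ (τ (i + 1)) - F₁ (τ i)) * (F₂ (σ (i + 1)) - F₂ (σ i))) with hS
  obtain ⟨ε, hε0, hε1, hεv⟩ : ∃ ε : ℝ, 0 < ε ∧ ε ≤ 1 ∧ v < √(1 - ε) * S := by
    have h : Tendsto (fun ε : ℝ => √(1 - ε) * S) (nhdsWithin 0 (Set.Ioi 0)) (nhds S) := by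
      have : Tendsto (fun ε : ℝ => √(1 - ε) * S) (nhds 0) (nhds (√(1 - 0) * S)) :=
        (by fun_prop : Continuous fun ε : ℝ => √(1 - ε) * S).tendsto 0
      rw [sub_zero, Real.sqrt_one, one_mul] at this
      exact this.mono_left nhdsWithin_le_nhds
    have h1 : ∀ᶠ ε : ℝ in nhdsWithin 0 (Set.Ioi 0), ε ≤ 1 :=
      (eventually_le_nhds one_pos).filter_mono nhdsWithin_le_nhds
    obtain ⟨ε, ⟨a1, a2⟩, a3⟩ := (((h.eventually_const_lt hv).and h1).and
      self_mem_nhdsWithin).exists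
    exact ⟨ε, a3, a2, a1⟩
  let T : ∀ n, ℕ → Finset (A n) := fun n i =>
    upSet (p n) (c n + τ (i + 1) * s n) \ upSet (p n) (c n + τ i * s n)
  let U : ∀ n, ℕ → Finset (B n) := fun n i =>
    upSet (q n) (c n + σ (i + 1) * s n) \ upSet (q n) (c n + σ i * s n)
  have hs0 := hs.eventually_gt_atTop 0
  have hTs : ∀ i, ∀ᶠ n in atTop, ∑ x ∈ T n i, p n x =
      upMass (p n) (c n + τ (i + 1) * s n) - upMass (p n) (c n + τ i * s n) := fun i =>
    hs0.mono fun n hn => sum_upSet_sdiff (p n) (by have := hτ.monotone i.le_succ; gcongr)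
  have hUs : ∀ i, ∀ᶠ n in atTop, ∑ x ∈ U n i, q n x =
      upMass (q n) (c n + σ (i + 1) * s n) - upMass (q n) (c n + σ i * s n) := fun i =>
    hs0.mono fun n hn => sum_upSet_sdiff (q n) (by have := hσ i.le_succ; gcongr)
  have hTl : ∀ i, Tendsto (fun n => ∑ x ∈ T n i, p n x) atTop (nhds (F₁ (τ (i + 1)) - F₁ (τ i))) :=
    fun i => ((h₁ _).sub (h₁ _)).congr' ((hTs i).mono fun n h => h.symm)
  have hUl : ∀ i, Tendsto (fun n => ∑ x ∈ U n i, q n x) atTop (nhds (F₂ (σ (i + 1)) - F₂ (σ i))) :=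
    fun i => ((h₂ _).sub (h₂ _)).congr' ((hUs i).mono fun n h => h.symm)
  have hlim : Tendsto (fun n => √(1 - ε) * ∑ i ∈ Finset.range k,
      √((∑ x ∈ T n i, p n x) * ∑ y ∈ U n i, q n y)) atTop (nhds (√(1 - ε) * S)) :=
    (tendsto_finsetSum _ fun i _ => ((hTl i).mul (hUl i)).sqrt).const_mul _
  have hsm : ∀ᶠ n in atTop, ∀ i ∈ Finset.range k,
      Real.exp (-((τ i - σ (i + 1)) * s n)) ≤ ε * ∑ x ∈ T n i, p n x := by
    rw [eventually_all_finset]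
    intro i _
    have l1 : Tendsto (fun n => Real.exp (-((τ i - σ (i + 1)) * s n))) atTop (nhds 0) :=
      Real.tendsto_exp_neg_atTop_nhds_zero.comp (hs.const_mul_atTop (sub_pos.2 (hστ i)))
    have l2 := (hTl i).const_mul ε
    have : 0 < ε * (F₁ (τ (i + 1)) - F₁ (τ i)) :=
      mul_pos hε0 (sub_pos.2 (hF₁ (hτ i.lt_succ_self)))
    exact (l1.eventually_lt l2 this).mono fun n h => h.le
  filter_upwards [hlim.eventually_const_lt hεv, hsm, hs0] with n e1 e2 hn
  refine e1.le.trans (le_FD_of_pieces (hp n) (hq n) (Finset.range k) (T n) (U n)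
    (pairwiseDisjoint_upSet_sdiff (p n) (g := fun i => c n + τ i * s n) (fun i j h => by
      have := hτ.monotone h; dsimp only; gcongr) _)
    (pairwiseDisjoint_upSet_sdiff (q n) (g := fun i => c n + σ i * s n) (fun i j h => by
      have := hσ h; dsimp only; gcongr) _)
    (fun i => Real.exp (-(c n + τ i * s n))) (fun i _ x hx => ?_) (fun i _ => (Real.exp_pos _).le)
    hε1 fun i hi y hy => ?_)
  · simp only [T, Finset.mem_sdiff, mem_upSet] at hx
    exact (not_le.1 hx.2).le
  · have hy' : Real.exp (-(c n + σ (i + 1) * s n)) ≤ q n y := mem_upSet.1 (Finset.mem_sdiff.1 hy).1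
    have hU1 : ∑ z ∈ U n i, q n z ≤ 1 := by
      rw [← (hq n).2]
      exact Finset.sum_le_sum_of_subset_of_nonneg (Finset.subset_univ _) fun x _ _ => (hq n).1 x
    calc Real.exp (-(c n + τ i * s n)) * ∑ z ∈ U n i, q n z
        ≤ Real.exp (-(c n + τ i * s n)) := mul_le_of_le_one_right (Real.exp_pos _).le hU1
      _ = Real.exp (-(c n + σ (i + 1) * s n)) * Real.exp (-((τ i - σ (i + 1)) * s n)) := by
        rw [← Real.exp_add]; congr 1; ring
      _ ≤ q n y * (ε * ∑ x ∈ T n i, p n x) :=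
        mul_le_mul hy' (e2 i hi) (Real.exp_pos _).le ((hq n).1 y)
      _ = _ := by ring

end Asymptotics

theorem normalPDF_zero_one (t : ℝ) : normalPDF 0 1 t = ProbabilityTheory.gaussianPDFReal 0 1 t := by
  simp [normalPDF, ProbabilityTheory.gaussianPDFReal]

theorem stdG_eq (x : ℝ) : stdG x = (ProbabilityTheory.gaussianReal 0 1).real (Set.Iic x) := by
  rw [measureReal_def, ProbabilityTheory.gaussianReal_apply_eq_integral _ one_ne_zero,
    ENNReal.toReal_ofReal (integral_nonneg fun t =>
      ProbabilityTheory.gaussianPDFReal_nonneg 0 1 t)]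
  simp_rw [stdG, normalPDF_zero_one]

section CLT

variable {X : Type*} [Fintype X] {P : X → ℝ}

/-- A finite probability distribution as a `PMF`. -/
noncomputable def IsProb.toPMF (hP : IsProb P) : PMF X :=
  PMF.ofFintype (fun x => ENNReal.ofReal (P x)) (by
    rw [← ENNReal.ofReal_sum_of_nonneg fun x _ => hP.1 x, hP.2, ENNReal.ofReal_one])

theorem IsProb.integral_toPMF [MeasurableSpace X] [MeasurableSingletonClass X] (hP : IsProb P)
    (f : X → ℝ) : ∫ x, f x ∂hP.toPMF.toMeasure = ∑ x, P x * f x := by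
  rw [PMF.integral_eq_sum]
  simp [toPMF, ENNReal.toReal_ofReal (hP.1 _)]

theorem IsProb.iid (hP : IsProb P) (n : ℕ) : IsProb (iid P n) := by
  classical
  refine ⟨fun f => Finset.prod_nonneg fun i _ => hP.1 _, ?_⟩
  have := Finset.prod_univ_sum (fun _ : Fin n => (Finset.univ : Finset X)) fun _ x => P x
  simp only [hP.2, Finset.prod_const_one, Fintype.piFinset_univ] at this
  exact this.symm

theorem IsProb.infinitePi_real [MeasurableSpace X] [MeasurableSingletonClass X] (hP : IsProb P)
    (n : ℕ) (E : Finset (Fin n → X)) :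
    (Measure.infinitePi fun _ : ℕ => hP.toPMF.toMeasure).real
      {ω | (fun i : Fin n => ω i) ∈ E} = ∑ f ∈ E, RNG.iid P n f := by
  have hm := Measure.map_infinitePi_infinitePi_of_inj (P := fun _ : ℕ => hP.toPMF.toMeasure)
    (f := fun i : Fin n => (i : ℕ)) Fin.val_injective
  have hpi : Measure.infinitePi (fun _ : Fin n => hP.toPMF.toMeasure) =
      Measure.pi fun _ : Fin n => hP.toPMF.toMeasure := Measure.infinitePi_eq_pi _
  rw [hpi] at hm
  have h1 : (Measure.infinitePi fun _ : ℕ => hP.toPMF.toMeasure).real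
      {ω | (fun i : Fin n => ω i) ∈ E} =
      (Measure.pi fun _ : Fin n => hP.toPMF.toMeasure).real E := by
    rw [← hm, map_measureReal_apply (by fun_prop) E.measurableSet]
    rfl
  rw [h1, ← sum_measureReal_singleton]
  refine Finset.sum_congr rfl fun f _ => ?_
  rw [measureReal_def, Measure.pi_singleton, ENNReal.toReal_prod]
  refine Finset.prod_congr rfl fun i _ => ?_
  rw [PMF.toMeasure_apply_singleton _ _ (measurableSet_singleton _)]
  simp [toPMF, ENNReal.toReal_ofReal (hP.1 _)]

theorem tendsto_upMass_iid_standard (hP : IsProb P) (hV : 0 < V P) (w : ℝ) :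
    Tendsto (fun n : ℕ => upMass (iid P n) (n * H P + w * √(V P) * √n)) atTop
      (nhds (stdG w)) := by
  classical
  let _ : MeasurableSpace X := ⊤
  have : MeasurableSingletonClass X := ⟨fun _ => trivial⟩
  let μ : Measure (ℕ → X) := Measure.infinitePi fun _ : ℕ => hP.toPMF.toMeasure
  let g : X → ℝ := fun x => (-Real.log (P x) - H P) / √(V P)
  have hg : Measurable g := measurable_of_finite g
  have hmap : ∀ i : ℕ, μ.map (fun ω => ω i) = hP.toPMF.toMeasure := fun i =>
    Measure.infinitePi_map_eval _ i
  have hint : ∀ f : X → ℝ, ∫ ω, f (ω 0) ∂μ = ∑ x, P x * f x := fun f => by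
    rw [← hP.integral_toPMF, ← hmap 0, integral_map (measurable_pi_apply _).aemeasurable
      (measurable_of_finite f).aestronglyMeasurable]
  have hHsum : ∑ x, P x * (-Real.log (P x) - H P) = 0 := by
    simp_rw [mul_sub, Finset.sum_sub_distrib, ← Finset.sum_mul, hP.2, H]
    simp
  have clt := ProbabilityTheory.tendstoInDistribution_inv_sqrt_mul_sum (P := μ)
    (P' := ProbabilityTheory.gaussianReal 0 1) (X := fun i ω => g (ω i)) (Y := id)
    ProbabilityTheory.HasLaw.id
    (by
      rw [hint]
      simp_rw [g, ← mul_div_assoc, ← Finset.sum_div, hHsum, zero_div])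
    (by
      simp only [Pi.pow_apply]
      rw [hint fun x => g x ^ 2]
      simp_rw [g, div_pow, Real.sq_sqrt hV.le, ← mul_div_assoc, ← Finset.sum_div]
      exact div_self hV.ne')
    (ProbabilityTheory.iIndepFun_infinitePi fun _ => hg)
    (fun i => by
      refine ProbabilityTheory.IdentDistrib.comp (u := g) ⟨(measurable_pi_apply _).aemeasurable,
        (measurable_pi_apply _).aemeasurable, ?_⟩ hg
      rw [hmap, hmap])
  have hport := ProbabilityMeasure.tendsto_measure_of_null_frontier_of_tendsto' clt.tendsto
    (E := Set.Iic w) (by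
      have : NullSingletonClass (ProbabilityTheory.gaussianReal 0 1) :=
        ProbabilityTheory.nullSingletonClass_gaussianReal one_ne_zero
      simp)
  rw [stdG_eq]
  simp only [ProbabilityMeasure.coe_mk, Measure.map_id] at hport
  have hreal := (ENNReal.tendsto_toReal (measure_ne_top _ _)).comp hport
  refine hreal.congr' ?_
  filter_upwards [eventually_gt_atTop 0] with n hn
  have hn' : (0 : ℝ) < √n := Real.sqrt_pos.2 (by exact_mod_cast hn)
  have hV' : 0 < √(V P) := Real.sqrt_pos.2 hV
  let E : Finset (Fin n → X) := Finset.univ.filter fun f =>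
    ∑ i, -Real.log (P (f i)) ≤ n * H P + w * √(V P) * √n
  have hset : (fun ω : ℕ → X => (√n)⁻¹ * ∑ k ∈ Finset.range n, g (ω k)) ⁻¹' Set.Iic w =
      {ω | (fun i : Fin n => ω i) ∈ E} := by
    ext ω
    simp only [Set.mem_preimage, Set.mem_Iic, Set.mem_ofPred_eq, E, Finset.mem_filter,
      Finset.mem_univ, true_and]
    rw [inv_mul_le_iff₀ hn', ← Finset.sum_div, div_le_iff₀ hV', Finset.sum_sub_distrib,
      Finset.sum_const, Finset.card_range, nsmul_eq_mul, Finset.sum_range]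
    constructor <;> intro h <;> linarith
  simp only [Function.comp_apply]
  rw [Measure.map_apply (by fun_prop) measurableSet_Iic, hset, ← measureReal_def]
  refine (hP.infinitePi_real n E).trans ?_
  unfold upMass
  have hlog : ∀ f : Fin n → X, 0 < iid P n f →
      Real.log (iid P n f) = ∑ i, Real.log (P (f i)) := fun f hf =>
    Real.log_prod fun i hi => (Finset.prod_ne_zero_iff.1 hf.ne') i hi
  have hmem : ∀ f : Fin n → X, 0 < iid P n f →
      (f ∈ E ↔ f ∈ upSet (iid P n) (n * H P + w * √(V P) * √n)) := fun f hf => by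
    rw [mem_upSet, ← Real.le_log_iff_exp_le hf, hlog f hf]
    simp only [E, Finset.mem_filter, Finset.mem_univ, true_and, Finset.sum_neg_distrib]
    constructor <;> intro h <;> linarith
  rw [← Finset.sum_filter_add_sum_filter_not E (fun f => 0 < iid P n f)]
  have hz : ∑ f ∈ E with ¬ 0 < iid P n f, iid P n f = 0 :=
    Finset.sum_eq_zero fun f hf =>
      le_antisymm (not_lt.1 (Finset.mem_filter.1 hf).2) ((hP.iid n).1 f)
  rw [hz, add_zero]
  refine Finset.sum_congr ?_ fun _ _ => rfl
  ext f
  rw [Finset.mem_filter]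
  constructor
  · rintro ⟨h1, h2⟩
    exact (hmem f h2).1 h1
  · intro h
    have h2 : 0 < iid P n f := (Real.exp_pos _).trans_le (mem_upSet.1 h)
    exact ⟨(hmem f h2).2 h, h2⟩

end CLT

/-- `G` is a distribution function with continuous, everywhere positive density `g`. -/
structure IsSmoothCdf (G g : ℝ → ℝ) : Prop where
  continuous_pdf : Continuous g
  pdf_pos : ∀ x, 0 < g x
  integrable : Integrable g
  hasDerivAt : ∀ x, HasDerivAt G (g x) x
  tendsto_atBot : Tendsto G atBot (nhds 0)
  tendsto_atTop : Tendsto G atTop (nhds 1)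

namespace IsSmoothCdf

variable {G g : ℝ → ℝ}

theorem continuous (h : IsSmoothCdf G g) : Continuous G :=
  continuous_iff_continuousAt.2 fun x => (h.hasDerivAt x).continuousAt

theorem strictMono (h : IsSmoothCdf G g) : StrictMono G :=
  strictMono_of_deriv_pos fun x => by rw [(h.hasDerivAt x).deriv]; exact h.pdf_pos x

theorem pos (h : IsSmoothCdf G g) (x : ℝ) : 0 < G x :=
  (h.strictMono.monotone.le_of_tendsto h.tendsto_atBot (x - 1)).trans_lt
    (h.strictMono (sub_one_lt x))

theorem lt_one (h : IsSmoothCdf G g) (x : ℝ) : G x < 1 :=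
  (h.strictMono (lt_add_one x)).trans_le
    (h.strictMono.monotone.ge_of_tendsto h.tendsto_atTop (x + 1))

theorem integral_Ioi (h : IsSmoothCdf G g) (x : ℝ) : ∫ t in Set.Ioi x, g t = 1 - G x :=
  integral_Ioi_of_hasDerivAt_of_tendsto h.continuous.continuousWithinAt
    (fun x _ => h.hasDerivAt x) h.integrable.integrableOn h.tendsto_atTop

/-- Affine change of variables. -/
theorem comp_affine (h : IsSmoothCdf G g) {k : ℝ} (hk : 0 < k) (m : ℝ) :
    IsSmoothCdf (fun x => G (k * (x - m))) fun x => k * g (k * (x - m)) where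
  continuous_pdf := by have := h.continuous_pdf; fun_prop
  pdf_pos x := mul_pos hk (h.pdf_pos _)
  integrable := ((h.integrable.comp_mul_left' hk.ne').comp_sub_right m).const_mul k
  hasDerivAt x := by
    have h1 : HasDerivAt (fun x => k * (x - m)) k x := by
      simpa using ((hasDerivAt_id x).sub_const m).const_mul k
    rw [mul_comm]
    exact (h.hasDerivAt _).comp x h1
  tendsto_atBot := h.tendsto_atBot.comp
    ((tendsto_atBot_add_const_right _ (-m) tendsto_id).const_mul_atBot hk)
  tendsto_atTop := h.tendsto_atTop.comp
    ((tendsto_atTop_add_const_right _ (-m) tendsto_id).const_mul_atTop hk)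

end IsSmoothCdf

theorem continuous_normalPDF (m v : ℝ) : Continuous (normalPDF m v) := by
  unfold normalPDF; fun_prop

theorem isSmoothCdf_stdG : IsSmoothCdf stdG (normalPDF 0 1) := by
  have hint : Integrable (normalPDF 0 1) :=
    (ProbabilityTheory.integrable_gaussianPDFReal 0 1).congr
      (Eventually.of_forall fun t => (normalPDF_zero_one t).symm)
  refine ⟨continuous_normalPDF 0 1, fun x => by rw [normalPDF]; positivity, hint,
    fun x => ?_, ?_, ?_⟩
  · have h : stdG = fun x => stdG 0 + ∫ t in (0 : ℝ)..x, normalPDF 0 1 t := by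
      funext x
      rw [← intervalIntegral.integral_Iic_sub_Iic hint.integrableOn hint.integrableOn]
      simp [stdG]
    rw [h]
    exact (((continuous_normalPDF 0 1).integral_hasStrictDerivAt 0 x).hasDerivAt).const_add _
  · exact (ProbabilityTheory.tendsto_cdf_atBot (ProbabilityTheory.gaussianReal 0 1)).congr
      fun x => by rw [ProbabilityTheory.cdf_eq_real, stdG_eq]
  · exact (ProbabilityTheory.tendsto_cdf_atTop (ProbabilityTheory.gaussianReal 0 1)).congr
      fun x => by rw [ProbabilityTheory.cdf_eq_real, stdG_eq]

section MovingThreshold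

variable {X Y : Type*} [Fintype X] [Fintype Y] {P : X → ℝ} {Q : Y → ℝ}

theorem tendsto_upMass_iid (hP : IsProb P) (hV : 0 < V P) {L : ℕ → ℕ} (hL : Tendsto L atTop atTop)
    {a : ℕ → ℝ} {z : ℝ}
    (ha : Tendsto (fun n => (a n - L n * H P) / √(L n)) atTop (nhds z)) :
    Tendsto (fun n => upMass (iid P (L n)) (a n)) atTop (nhds (stdG (z / √(V P)))) := by
  have hV' : 0 < √(V P) := Real.sqrt_pos.2 hV
  have hcont : Continuous fun y => stdG (y / √(V P)) :=
    isSmoothCdf_stdG.continuous.comp (continuous_id.div_const _)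
  have hstd : ∀ y, Tendsto (fun n => upMass (iid P (L n)) (L n * H P + y * √(L n))) atTop
      (nhds (stdG (y / √(V P)))) := fun y => by
    have h := (tendsto_upMass_iid_standard hP hV (y / √(V P))).comp hL
    simpa only [Function.comp_def, div_mul_cancel₀ y hV'.ne'] using h
  have hpos : ∀ᶠ n in atTop, 0 < √(L n : ℝ) := by
    filter_upwards [hL.eventually_gt_atTop 0] with n hn
    exact Real.sqrt_pos.2 (by exact_mod_cast hn)
  rw [tendsto_order]
  constructor
  · intro u hu
    obtain ⟨y, hy, hyz⟩ := ((hcont.tendsto z).eventually_const_lt hu).filter_mono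
      (nhdsWithin_le_nhds (s := Set.Iio z)) |>.and self_mem_nhdsWithin |>.exists
    filter_upwards [(hstd y).eventually_const_lt hy, ha.eventually_const_lt hyz, hpos]
      with n h1 h2 h3
    refine h1.trans_le (upMass_mono _ ?_)
    rw [lt_div_iff₀ h3] at h2
    linarith
  · intro u hu
    obtain ⟨y, hy, hyz⟩ := ((hcont.tendsto z).eventually_lt_const hu).filter_mono
      (nhdsWithin_le_nhds (s := Set.Ioi z)) |>.and self_mem_nhdsWithin |>.exists
    filter_upwards [(hstd y).eventually_lt_const hy, ha.eventually_lt_const hyz, hpos]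
      with n h1 h2 h3
    refine (upMass_mono _ ?_).trans_lt h1
    rw [div_lt_iff₀ h3] at h2
    linarith

theorem entropy_pos (hP : IsProb P) (hV : 0 < V P) : 0 < H P := by
  have hle : ∀ x, P x ≤ 1 := fun x =>
    hP.2 ▸ Finset.single_le_sum (fun y _ => hP.1 y) (Finset.mem_univ x)
  have hterm : ∀ x, 0 ≤ -(P x * Real.log (P x)) := fun x => by
    rw [← mul_neg]
    exact mul_nonneg (hP.1 x) (neg_nonneg.2 (Real.log_nonpos (hP.1 x) (hle x)))
  refine (Finset.sum_nonneg fun x _ => hterm x).lt_of_ne fun h0 => hV.ne' ?_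
  have hz := (Finset.sum_eq_zero_iff_of_nonneg fun x _ => hterm x).1 h0.symm
  refine Finset.sum_eq_zero fun x hx => ?_
  have hH : H P = 0 := h0.symm
  have := hz x hx
  rw [hH]
  linear_combination Real.log (P x) * (-this)

theorem tendsto_upMass_source (hP : IsProb P) (hV : 0 < V P) (t : ℝ) :
    Tendsto (fun n : ℕ => upMass (iid P n) (n * H P + t * √n)) atTop (nhds (GP P t)) := by
  refine tendsto_upMass_iid hP hV tendsto_id ?_
  refine tendsto_const_nhds.congr' ?_
  filter_upwards [eventually_gt_atTop 0] with n hn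
  have : √(n : ℝ) ≠ 0 := (Real.sqrt_pos.2 (by exact_mod_cast hn)).ne'
  simp only [id]
  field_simp
  ring

theorem tendsto_upMass_target (hQ : IsProb Q) (hP : IsProb P) (hVP : 0 < V P) (hV : 0 < V Q)
    (b t : ℝ) :
    Tendsto (fun n : ℕ => upMass (iid Q ⌊H P / H Q * n + b * √n⌋₊) (n * H P + t * √n)) atTop
      (nhds (GPQ P Q b t)) := by
  have hHP := entropy_pos hP hVP
  have hHQ := entropy_pos hQ hV
  have hk : 0 < H P / H Q := div_pos hHP hHQ
  let y : ℕ → ℝ := fun n => H P / H Q * n + b * √n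
  have hsq : Tendsto (fun n : ℕ => √(n : ℝ)) atTop atTop :=
    Real.tendsto_sqrt_atTop.comp tendsto_natCast_atTop_atTop
  have hyn : ∀ n, y n = √n * (H P / H Q * √n + b) := fun n => by
    simp only [y]
    linear_combination (H P / H Q) * (-Real.mul_self_sqrt (Nat.cast_nonneg (α := ℝ) n))
  have hy : Tendsto y atTop atTop := by
    refine Tendsto.congr (fun n => (hyn n).symm) ?_
    exact hsq.atTop_mul_atTop₀ (tendsto_atTop_add_const_right _ b (hsq.const_mul_atTop hk))
  have hL : Tendsto (fun n => ⌊y n⌋₊) atTop atTop := tendsto_nat_floor_atTop.comp hy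
  have hinv : Tendsto (fun n : ℕ => (√(n : ℝ))⁻¹) atTop (nhds 0) := tendsto_inv_atTop_zero.comp hsq
  have hδ : Tendsto (fun n => (y n - ⌊y n⌋₊) * (√(n : ℝ))⁻¹) atTop (nhds 0) := by
    refine squeeze_zero' ?_ ?_ hinv
    · filter_upwards [hy.eventually_ge_atTop 0] with n hn
      exact mul_nonneg (sub_nonneg.2 (Nat.floor_le hn)) (by positivity)
    · refine Eventually.of_forall fun n => ?_
      have := (Nat.lt_floor_add_one (y n)).le
      exact mul_le_of_le_one_left (by positivity) (by linarith)
  have hratio : Tendsto (fun n => √(⌊y n⌋₊ : ℝ) * (√(n : ℝ))⁻¹) atTop (nhds √(H P / H Q)) := by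
    have h1 : Tendsto (fun n : ℕ => H P / H Q + (b - (y n - ⌊y n⌋₊) * (√(n : ℝ))⁻¹) * (√(n : ℝ))⁻¹)
        atTop (nhds (H P / H Q)) := by
      simpa using ((tendsto_const_nhds.sub hδ).mul hinv).const_add (H P / H Q)
    refine ((Real.continuous_sqrt.tendsto _).comp h1).congr' ?_
    filter_upwards [eventually_gt_atTop 0] with n hn
    have hn0 : 0 < √(n : ℝ) := Real.sqrt_pos.2 (by exact_mod_cast hn)
    have hsn : √(n : ℝ) ^ 2 = n := Real.sq_sqrt (Nat.cast_nonneg n)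
    have : H P / H Q + (b - (y n - ⌊y n⌋₊) * (√(n : ℝ))⁻¹) * (√(n : ℝ))⁻¹ =
        (⌊y n⌋₊ : ℝ) * ((√(n : ℝ))⁻¹) ^ 2 := by
      rw [hyn]
      field_simp
      ring
    simp only [Function.comp_apply]
    rw [this, Real.sqrt_mul (Nat.cast_nonneg _), Real.sqrt_sq (by positivity)]
  have hnum : Tendsto (fun n : ℕ => t - H Q * b + H Q * ((y n - ⌊y n⌋₊) * (√(n : ℝ))⁻¹)) atTop
      (nhds (t - H Q * b)) := by
    simpa using (hδ.const_mul (H Q)).const_add (t - H Q * b)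
  have hmain := hnum.div hratio (Real.sqrt_pos.2 hk).ne'
  have hlim := tendsto_upMass_iid hQ hV hL (a := fun n => n * H P + t * √n) (hmain.congr' (by
    filter_upwards [eventually_gt_atTop 0] with n hn
    have hn0 : 0 < √(n : ℝ) := Real.sqrt_pos.2 (by exact_mod_cast hn)
    have hsn : √(n : ℝ) * √n = n := Real.mul_self_sqrt (Nat.cast_nonneg n)
    have hnum' : t - H Q * b + H Q * ((y n - ⌊y n⌋₊) * (√(n : ℝ))⁻¹) =
        (n * H P + t * √n - ⌊y n⌋₊ * H Q) * (√(n : ℝ))⁻¹ := by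
      have : y n * H Q = n * H P + b * √n * H Q := by
        simp only [y]; field_simp
      field_simp
      linear_combination this
    simp only [Pi.div_apply]
    rw [hnum', mul_div_mul_right _ _ (inv_pos.2 hn0).ne']))
  convert hlim using 2
  unfold GPQ
  congr 1
  have hinv' : H Q / (H P * V Q) = (H P / H Q * V Q)⁻¹ := by field_simp
  rw [div_div, ← Real.sqrt_mul hk.le, hinv', Real.sqrt_inv, mul_comm]
  exact (div_eq_mul_inv _ _).symm

end MovingThreshold

namespace IsSmoothCdf

variable {G g G₁ g₁ G₂ g₂ : ℝ → ℝ}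

theorem surjOn (h : IsSmoothCdf G g) {y : ℝ} (h0 : 0 < y) (h1 : y < 1) : ∃ x, G x = y := by
  obtain ⟨a, ha⟩ := (h.tendsto_atBot.eventually_lt_const h0).exists
  obtain ⟨b, hb⟩ := (h.tendsto_atTop.eventually_const_lt h1).exists
  exact mem_range_of_exists_le_of_exists_ge h.continuous ⟨a, ha.le⟩ ⟨b, hb.le⟩

theorem integral_Iic (h : IsSmoothCdf G g) (x : ℝ) : ∫ t in Set.Iic x, g t = G x := by
  rw [integral_Iic_of_hasDerivAt_of_tendsto h.continuous.continuousWithinAt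
    (fun x _ => h.hasDerivAt x) h.integrable.integrableOn h.tendsto_atBot, sub_zero]

theorem integral_interval (h : IsSmoothCdf G g) (a b : ℝ) : ∫ t in a..b, g t = G b - G a :=
  intervalIntegral.integral_eq_sub_of_hasDerivAt (fun x _ => h.hasDerivAt x)
    (h.continuous_pdf.intervalIntegrable _ _)

theorem integrable_sqrt_mul (h₁ : IsSmoothCdf G₁ g₁) (h₂ : IsSmoothCdf G₂ g₂) :
    Integrable fun t => √(g₁ t * g₂ t) := by
  refine (h₁.integrable.add h₂.integrable).mono'
    (h₁.continuous_pdf.mul h₂.continuous_pdf).sqrt.aestronglyMeasurable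
    (Eventually.of_forall fun t => ?_)
  have p1 := (h₁.pdf_pos t).le
  have p2 := (h₂.pdf_pos t).le
  rw [Real.norm_of_nonneg (Real.sqrt_nonneg _), Pi.add_apply]
  exact Real.sqrt_le_iff.2 ⟨by positivity, by nlinarith [mul_nonneg p1 p2]⟩

end IsSmoothCdf

/-- Cauchy–Schwarz inequality for interval integrals of continuous positive functions. -/
theorem integral_sqrt_mul_le {u w : ℝ → ℝ} (hu : Continuous u) (hw : Continuous w)
    (hu0 : ∀ x, 0 < u x) (hw0 : ∀ x, 0 < w x) {a b : ℝ} (hab : a < b) :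
    ∫ x in a..b, √(u x * w x) ≤ √((∫ x in a..b, u x) * ∫ x in a..b, w x) := by
  have hU : 0 < ∫ x in a..b, u x :=
    intervalIntegral.intervalIntegral_pos_of_pos (hu.intervalIntegrable _ _) hu0 hab
  have hW : 0 < ∫ x in a..b, w x :=
    intervalIntegral.intervalIntegral_pos_of_pos (hw.intervalIntegrable _ _) hw0 hab
  set U := ∫ x in a..b, u x
  set W := ∫ x in a..b, w x
  have sU : 0 < √U := Real.sqrt_pos.2 hU
  have sW : 0 < √W := Real.sqrt_pos.2 hW
  have hle : ∀ x, √(u x * w x) ≤ (√W / √U * u x + √U / √W * w x) / 2 := fun x => by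
    have p1 := hu0 x
    have p2 := hw0 x
    refine Real.sqrt_le_iff.2 ⟨by positivity, ?_⟩
    have : u x * w x = (√W / √U * u x) * (√U / √W * w x) := by field_simp
    rw [this]
    nlinarith [sq_nonneg (√W / √U * u x - √U / √W * w x)]
  calc ∫ x in a..b, √(u x * w x)
      ≤ ∫ x in a..b, (√W / √U * u x + √U / √W * w x) / 2 :=
        intervalIntegral.integral_mono_on hab.le
          ((hu.mul hw).sqrt.intervalIntegrable _ _)
          (Continuous.intervalIntegrable (by fun_prop) _ _) fun x _ => hle x
    _ = (√W / √U * U + √U / √W * W) / 2 := by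
        rw [intervalIntegral.integral_div, intervalIntegral.integral_add
          ((hu.const_mul _).intervalIntegrable _ _) ((hw.const_mul _).intervalIntegrable _ _),
          intervalIntegral.integral_const_mul, intervalIntegral.integral_const_mul]
    _ = √(U * W) := by
        rw [Real.sqrt_mul hU.le]
        field_simp
        rw [Real.sq_sqrt hU.le, Real.sq_sqrt hW.le]
        ring

/-- If `G ≥ G₁` is a smooth distribution function, then any value below `∫ √(g g₂)` is reached by
a discretised coupling in which `G₁` is shifted strictly to the right of `G₂`. -/
theorem exists_grid {G₁ g₁ G₂ g₂ G g : ℝ → ℝ} (h₁ : IsSmoothCdf G₁ g₁) (h₂ : IsSmoothCdf G₂ g₂)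
    (h : IsSmoothCdf G g) (hle : ∀ x, G₁ x ≤ G x) {v : ℝ} (hv : v < ∫ t, √(g t * g₂ t)) :
    ∃ (k : ℕ) (σ τ : ℕ → ℝ), Monotone σ ∧ StrictMono τ ∧ (∀ i, σ (i + 1) < τ i) ∧
      v < ∑ i ∈ Finset.range k,
        √((G₁ (τ (i + 1)) - G₁ (τ i)) * (G₂ (σ (i + 1)) - G₂ (σ i))) := by
  have cg := h.continuous_pdf
  have cg₂ := h₂.continuous_pdf
  obtain ⟨M, hM0, hM⟩ := ((eventually_gt_atTop (0 : ℝ)).and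
    ((intervalIntegral_tendsto_integral (h.integrable_sqrt_mul h₂) tendsto_neg_atTop_atBot
      tendsto_id).eventually_const_lt hv)).exists
  simp only [id] at hM
  set A := -M
  have hAM : 0 < M - A := by simp only [A]; linarith
  let J : ℝ → ℝ := fun h => ∫ x in A..M, √(g (x + 2 * h) * g₂ x)
  have hJ : Continuous J :=
    intervalIntegral.continuous_parametric_intervalIntegral_of_continuous' (by fun_prop) _ _
  have hJ0 : v < J 0 := by simpa [J] using hM
  have hstep : Tendsto (fun k : ℕ => (M - A) / (k : ℝ)) atTop (nhds 0) :=
    tendsto_const_div_atTop_nhds_zero_nat _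
  obtain ⟨k, hk0, hk⟩ := ((eventually_gt_atTop 0).and
    (((hJ.tendsto 0).comp hstep).eventually_const_lt hJ0)).exists
  have hk0' : (0 : ℝ) < k := by exact_mod_cast hk0
  simp only [Function.comp_apply] at hk
  set d := (M - A) / (k : ℝ)
  have hd : 0 < d := div_pos hAM hk0'
  let σ : ℕ → ℝ := fun i => A + i * d
  have hσs : ∀ i, σ (i + 1) = σ i + d := fun i => by simp only [σ]; push_cast; ring
  have hσ : StrictMono σ := strictMono_nat_of_lt_succ fun i => by rw [hσs]; linarith
  choose τ hτ using fun i => h₁.surjOn (h.pos (σ (i + 2))) (h.lt_one (σ (i + 2)))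
  have hτm : StrictMono τ := fun i j hij => by
    rw [← h₁.strictMono.lt_iff_lt, hτ, hτ]
    exact h.strictMono (hσ (by omega))
  refine ⟨k, σ, τ, hσ.monotone, hτm, fun i => ?_, hk.trans_le ?_⟩
  · rw [← h₁.strictMono.lt_iff_lt, hτ]
    exact (hle _).trans_lt (h.strictMono (hσ (by omega)))
  have hsum := intervalIntegral.sum_integral_adjacent_intervals (μ := volume)
    (f := fun x => √(g (x + 2 * d) * g₂ x)) (a := σ) (n := k) fun i _ =>
      Continuous.intervalIntegrable (by fun_prop) _ _
  have hσ0 : σ 0 = A := by simp [σ]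
  have hσk : σ k = M := by simp only [σ, d]; field_simp; ring
  rw [hσ0, hσk] at hsum
  simp only [J]
  rw [← hsum]
  refine Finset.sum_le_sum fun i _ => ?_
  have hcs := integral_sqrt_mul_le (u := fun x => g (x + 2 * d)) (w := g₂) (by fun_prop) cg₂
    (fun x => h.pdf_pos _) h₂.pdf_pos (hσ (Nat.lt_succ_self i))
  refine hcs.trans_eq ?_
  rw [intervalIntegral.integral_comp_add_right g, h.integral_interval, h₂.integral_interval,
    hτ, hτ]
  have e : ∀ j, σ j + 2 * d = σ (j + 2) := fun j => by rw [hσs, hσs]; ring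
  rw [e, e]

section Ratio

variable {G₁ g₁ G₂ g₂ φ φ' : ℝ → ℝ} {α : ℝ}

theorem deriv_nonneg_of_ratio (h₁ : IsSmoothCdf G₁ g₁) (h₂ : IsSmoothCdf G₂ g₂)
    (hφ : ∀ t, HasDerivAt φ (φ' t) t) (hφ' : Monotone φ')
    (hg : ∀ t, g₂ t = Real.exp (2 * φ t) * g₁ t)
    (hα : G₂ α = Real.exp (2 * φ α) * G₁ α) : 0 ≤ φ' α := by
  by_contra! hneg
  have hφc : Continuous φ := continuous_iff_continuousAt.2 fun x => (hφ x).continuousAt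
  have hanti : StrictAntiOn φ (Set.Iic α) :=
    strictAntiOn_of_deriv_neg (convex_Iic α) hφc.continuousOn fun x hx => by
      rw [interior_Iic] at hx
      rw [(hφ x).deriv]
      exact (hφ' hx.le).trans_lt hneg
  let D : ℝ → ℝ := fun t => G₂ t - Real.exp (2 * φ α) * G₁ t
  have hD : ∀ t, HasDerivAt D (g₂ t - Real.exp (2 * φ α) * g₁ t) t := fun t =>
    (h₂.hasDerivAt t).sub ((h₁.hasDerivAt t).const_mul _)
  have hmono : StrictMonoOn D (Set.Iic α) :=
    strictMonoOn_of_deriv_pos (convex_Iic α)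
      (continuous_iff_continuousAt.2 fun x => (hD x).continuousAt).continuousOn fun x hx => by
      rw [interior_Iic] at hx
      rw [(hD x).deriv, hg, ← sub_mul]
      refine mul_pos (sub_pos.2 (Real.exp_lt_exp.2 ?_)) (h₁.pdf_pos x)
      linarith [hanti (Set.mem_Iic.2 (le_of_lt hx)) (Set.mem_Iic.2 le_rfl) hx]
  have hlim : Tendsto D atBot (nhds 0) := by
    simpa [D] using h₂.tendsto_atBot.sub (h₁.tendsto_atBot.const_mul (Real.exp (2 * φ α)))
  have h1 : D (α - 1) < D α := hmono (by simp) (by simp) (by simp)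
  have h2 : D α = 0 := by simp [D, hα]
  have h3 : 0 ≤ D (α - 1) := by
    refine le_of_tendsto hlim ?_
    filter_upwards [eventually_le_atBot (α - 1)] with t ht
    exact hmono.monotoneOn (ht.trans (sub_one_lt α).le) (sub_one_lt α).le ht
  linarith

theorem mul_cdf_le_of_ratio (h₁ : IsSmoothCdf G₁ g₁) (h₂ : IsSmoothCdf G₂ g₂)
    (hφ : ConvexOn ℝ Set.univ φ)
    (hg : ∀ t, g₂ t = Real.exp (2 * φ t) * g₁ t)
    (hα : G₂ α = Real.exp (2 * φ α) * G₁ α) {s : ℝ} (hs : s ≤ α) :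
    Real.exp (2 * φ α) * G₁ s ≤ G₂ s := by
  let D : ℝ → ℝ := fun t => G₂ t - Real.exp (2 * φ α) * G₁ t
  have hD : ∀ t, HasDerivAt D (g₂ t - Real.exp (2 * φ α) * g₁ t) t := fun t =>
    (h₂.hasDerivAt t).sub ((h₁.hasDerivAt t).const_mul _)
  have hDc : Continuous D := continuous_iff_continuousAt.2 fun x => (hD x).continuousAt
  have hlim : Tendsto D atBot (nhds 0) := by
    simpa [D] using h₂.tendsto_atBot.sub (h₁.tendsto_atBot.const_mul (Real.exp (2 * φ α)))
  have h2 : D α = 0 := by simp [D, hα]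
  suffices 0 ≤ D s by simpa [D] using this
  rcases lt_or_ge (φ α) (φ s) with hlt | hge
  · have hmono : MonotoneOn D (Set.Iic s) :=
      monotoneOn_of_deriv_nonneg (convex_Iic s) hDc.continuousOn
        (fun x _ => (hD x).differentiableAt.differentiableWithinAt) fun x hx => by
        rw [interior_Iic] at hx
        rw [(hD x).deriv, hg, ← sub_mul]
        refine mul_nonneg (sub_nonneg.2 (Real.exp_le_exp.2 ?_)) (h₁.pdf_pos x).le
        have := hφ.le_max_of_mem_Icc (Set.mem_univ x) (Set.mem_univ α) ⟨hx.le, hs⟩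
        rcases le_max_iff.1 this with h | h <;> linarith
    refine le_of_tendsto hlim ?_
    filter_upwards [eventually_le_atBot s] with t ht
    exact hmono ht (Set.mem_Iic.2 le_rfl) ht
  · have hanti : AntitoneOn D (Set.Icc s α) :=
      antitoneOn_of_deriv_nonpos (convex_Icc s α) hDc.continuousOn
        (fun x _ => (hD x).differentiableAt.differentiableWithinAt) fun x hx => by
        rw [interior_Icc] at hx
        rw [(hD x).deriv, hg, ← sub_mul]
        refine mul_nonpos_of_nonpos_of_nonneg (sub_nonpos.2 (Real.exp_le_exp.2 ?_))
          (h₁.pdf_pos x).le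
        have := hφ.le_max_of_mem_Icc (Set.mem_univ s) (Set.mem_univ α) ⟨hx.1.le, hx.2.le⟩
        rcases le_max_iff.1 this with h | h <;> linarith
    rw [← h2]
    exact hanti ⟨le_rfl, hs⟩ ⟨hs, le_rfl⟩ hs

end Ratio

section Ratio

variable {G₁ g₁ G₂ g₂ φ φ' : ℝ → ℝ} {α : ℝ}

theorem sqrt_mul_of_ratio (h₁ : IsSmoothCdf G₁ g₁) (hg : ∀ t, g₂ t = Real.exp (2 * φ t) * g₁ t)
    (t : ℝ) : √(g₁ t * g₂ t) = Real.exp (φ t) * g₁ t := by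
  have : g₁ t * g₂ t = (Real.exp (φ t) * g₁ t) ^ 2 := by
    rw [hg, two_mul, Real.exp_add]; ring
  rw [this, Real.sqrt_sq (mul_pos (Real.exp_pos _) (h₁.pdf_pos t)).le]

theorem sqrt_cdf_mul_of_ratio (h₁ : IsSmoothCdf G₁ g₁)
    (hα : G₂ α = Real.exp (2 * φ α) * G₁ α) : √(G₁ α * G₂ α) = Real.exp (φ α) * G₁ α := by
  have : G₁ α * G₂ α = (Real.exp (φ α) * G₁ α) ^ 2 := by
    rw [hα, two_mul, Real.exp_add]; ring
  rw [this, Real.sqrt_sq (mul_pos (Real.exp_pos _) (h₁.pos α)).le]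

/-- Up to `α` the distribution function proportional to `G₂`, beyond `α` the function `G₁`. -/
noncomputable def glue (G₁ G₂ : ℝ → ℝ) (c α x : ℝ) : ℝ := if x ≤ α then c * G₂ x else G₁ x

theorem isSmoothCdf_glue (h₁ : IsSmoothCdf G₁ g₁) (h₂ : IsSmoothCdf G₂ g₂) {c : ℝ} (hc : 0 < c)
    (hG : c * G₂ α = G₁ α) (hg : c * g₂ α = g₁ α) :
    IsSmoothCdf (glue G₁ G₂ c α) (glue g₁ g₂ c α) := by
  have hcont : Continuous (glue g₁ g₂ c α) :=
    Continuous.if_le (h₂.continuous_pdf.const_mul c) h₁.continuous_pdf continuous_id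
      continuous_const fun x hx => by rw [hx, hg]
  refine ⟨hcont, fun x => ?_, ?_, fun x => ?_, ?_, ?_⟩
  · unfold glue
    split_ifs
    exacts [mul_pos hc (h₂.pdf_pos x), h₁.pdf_pos x]
  · refine ((h₂.integrable.const_mul c).add h₁.integrable).mono' hcont.aestronglyMeasurable
      (Eventually.of_forall fun x => ?_)
    have p1 := mul_pos hc (h₂.pdf_pos x)
    have p2 := h₁.pdf_pos x
    unfold glue
    simp only [Pi.add_apply]
    split_ifs
    · rw [Real.norm_of_nonneg p1.le]; linarith
    · rw [Real.norm_of_nonneg p2.le]; linarith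
  · rcases lt_trichotomy x α with hx | rfl | hx
    · have : glue G₁ G₂ c α =ᶠ[nhds x] fun y => c * G₂ y := by
        filter_upwards [eventually_lt_nhds hx] with y hy
        simp [glue, hy.le]
      simpa [glue, hx.le] using ((h₂.hasDerivAt x).const_mul c).congr_of_eventuallyEq this
    · have l : HasDerivWithinAt (glue G₁ G₂ c x) (glue g₁ g₂ c x x) (Set.Iic x) x := by
        have := ((h₂.hasDerivAt x).const_mul c).hasDerivWithinAt (s := Set.Iic x)
        simpa [glue] using this.congr (fun y hy => by simp [glue, Set.mem_Iic.1 hy])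
          (by simp [glue])
      have r : HasDerivWithinAt (glue G₁ G₂ c x) (glue g₁ g₂ c x x) (Set.Ici x) x := by
        have := (h₁.hasDerivAt x).hasDerivWithinAt (s := Set.Ici x)
        have e : glue g₁ g₂ c x x = g₁ x := by simp [glue, hg]
        rw [e]
        refine this.congr (fun y hy => ?_) (by simp [glue, hG])
        rcases (Set.mem_Ici.1 hy).eq_or_lt with rfl | h
        · simp [glue, hG]
        · simp [glue, h.not_ge]
      simpa using l.union r
    · have : glue G₁ G₂ c α =ᶠ[nhds x] G₁ := by
        filter_upwards [eventually_gt_nhds hx] with y hy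
        simp [glue, hy.not_ge]
      simpa [glue, hx.not_ge] using (h₁.hasDerivAt x).congr_of_eventuallyEq this
  · have : Tendsto (fun x => c * G₂ x) atBot (nhds 0) := by
      simpa using h₂.tendsto_atBot.const_mul c
    refine this.congr' ?_
    filter_upwards [eventually_le_atBot α] with y hy
    simp [glue, hy]
  · refine h₁.tendsto_atTop.congr' ?_
    filter_upwards [eventually_gt_atTop α] with y hy
    simp [glue, not_le.2 hy]

theorem exists_grid_of_ratio (h₁ : IsSmoothCdf G₁ g₁) (h₂ : IsSmoothCdf G₂ g₂)
    (hφ : ConvexOn ℝ Set.univ φ)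
    (hg : ∀ t, g₂ t = Real.exp (2 * φ t) * g₁ t)
    (hα : G₂ α = Real.exp (2 * φ α) * G₁ α) {v : ℝ}
    (hv : v < √(G₁ α * G₂ α) + ∫ t in Set.Ioi α, √(g₁ t * g₂ t)) :
    ∃ (k : ℕ) (σ τ : ℕ → ℝ), Monotone σ ∧ StrictMono τ ∧ (∀ i, σ (i + 1) < τ i) ∧
      v < ∑ i ∈ Finset.range k,
        √((G₁ (τ (i + 1)) - G₁ (τ i)) * (G₂ (σ (i + 1)) - G₂ (σ i))) := by
  have hc : Real.exp (-(2 * φ α)) * Real.exp (2 * φ α) = 1 := by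
    rw [← Real.exp_add, neg_add_cancel, Real.exp_zero]
  have hglue := isSmoothCdf_glue h₁ h₂ (Real.exp_pos (-(2 * φ α)))
    (by rw [hα, ← mul_assoc, hc, one_mul]) (by rw [hg, ← mul_assoc, hc, one_mul])
  refine exists_grid h₁ h₂ hglue (fun x => ?_) (hv.trans_eq ?_)
  · unfold glue
    split_ifs with hx
    · have := mul_le_mul_of_nonneg_left (mul_cdf_le_of_ratio h₁ h₂ hφ hg hα hx)
        (Real.exp_pos (-(2 * φ α))).le
      rwa [← mul_assoc, hc, one_mul] at this
    · exact le_rfl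
  · have hint := hglue.integrable_sqrt_mul h₂
    rw [← intervalIntegral.integral_Iic_add_Ioi (b := α) hint.integrableOn hint.integrableOn]
    congr 1
    · have : ∀ t ∈ Set.Iic α, √(glue g₁ g₂ (Real.exp (-(2 * φ α))) α t * g₂ t) =
          Real.exp (-φ α) * g₂ t := fun t ht => by
        have : glue g₁ g₂ (Real.exp (-(2 * φ α))) α t * g₂ t = (Real.exp (-φ α) * g₂ t) ^ 2 := by
          rw [glue, if_pos (Set.mem_Iic.1 ht), two_mul, neg_add, Real.exp_add]; ring
        rw [this, Real.sqrt_sq (mul_pos (Real.exp_pos _) (h₂.pdf_pos t)).le]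
      rw [setIntegral_congr_fun measurableSet_Iic this, integral_const_mul, h₂.integral_Iic,
        sqrt_cdf_mul_of_ratio h₁ hα, hα, ← mul_assoc, ← Real.exp_add]
      congr 2
      ring
    · refine setIntegral_congr_fun measurableSet_Ioi fun t ht => ?_
      simp only [glue, if_neg (not_le.2 (Set.mem_Ioi.1 ht))]

/-- The dual bound obtained from the test function `√(g₂ / g₁)` on `[α, M]`. -/
theorem exists_dual_bound (h₁ : IsSmoothCdf G₁ g₁) (h₂ : IsSmoothCdf G₂ g₂)
    (hφ : ∀ t, HasDerivAt φ (φ' t) t) (hφ' : Monotone φ') (hφc : Continuous φ')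
    (hg : ∀ t, g₂ t = Real.exp (2 * φ t) * g₁ t)
    (hα : G₂ α = Real.exp (2 * φ α) * G₁ α) {v : ℝ}
    (hv : √(G₁ α * G₂ α) + ∫ t in Set.Ioi α, √(g₁ t * g₂ t) < v) :
    ∃ M, α ≤ M ∧
      (Real.exp (φ α) + ∫ t in α..M, Real.exp (φ t) * φ' t * (1 - G₁ t)) +
      (1 / Real.exp (φ α) + ∫ t in α..M,
        -(Real.exp (φ t) * φ' t) / Real.exp (φ t) ^ 2 * (1 - G₂ t)) < 2 * v := by
  have hφα := deriv_nonneg_of_ratio h₁ h₂ hφ hφ' hg hα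
  have cφ : Continuous φ := continuous_iff_continuousAt.2 fun x => (hφ x).continuousAt
  have hmono : MonotoneOn φ (Set.Ici α) :=
    monotoneOn_of_deriv_nonneg (convex_Ici α) cφ.continuousOn
      (fun x _ => (hφ x).differentiableAt.differentiableWithinAt) fun x hx => by
      rw [interior_Ici] at hx
      rw [(hφ x).deriv]
      exact hφα.trans (hφ' (le_of_lt hx))
  have hint := h₁.integrable_sqrt_mul h₂
  set S := ∫ t in Set.Ioi α, √(g₁ t * g₂ t) with hS
  have htail : Tendsto (fun M => (∫ t in Set.Ioi M, √(g₁ t * g₂ t)) +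
      (1 - G₂ M) * Real.exp (-φ α)) atTop (nhds 0) := by
    have t1 : Tendsto (fun M => ∫ t in Set.Ioi M, √(g₁ t * g₂ t)) atTop (nhds 0) :=
      tendsto_integral_Ioi_zero tendsto_id
    have t2 := (h₂.tendsto_atTop.const_sub 1).mul_const (Real.exp (-φ α))
    simpa using t1.add t2
  obtain ⟨M, hM, hαM⟩ := ((htail.eventually_lt_const
    (show 0 < 2 * (v - (√(G₁ α * G₂ α) + S)) by linarith)).and (eventually_ge_atTop α)).exists
  refine ⟨M, hαM, ?_⟩
  have hsub : ∫ t in α..M, √(g₁ t * g₂ t) ≤ S := by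
    rw [intervalIntegral.integral_of_le hαM]
    exact setIntegral_mono_set hint.integrableOn
      (Eventually.of_forall fun t => Real.sqrt_nonneg _)
      (Set.Ioc_subset_Ioi_self).eventuallyLE
  have hexp : ∀ t, HasDerivAt (fun t => Real.exp (φ t)) (Real.exp (φ t) * φ' t) t := fun t =>
    (hφ t).exp
  have hexpn : ∀ t, HasDerivAt (fun t => Real.exp (-φ t)) (Real.exp (-φ t) * -φ' t) t := fun t =>
    (hφ t).neg.exp
  have c1 := h₁.continuous_pdf
  have c2 := h₂.continuous_pdf
  have i1 := intervalIntegral.integral_mul_deriv_eq_deriv_mul (a := α) (b := M)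
    (fun t _ => (h₁.hasDerivAt t).const_sub 1) (fun t _ => hexp t)
    (Continuous.intervalIntegrable (by fun_prop) _ _)
    (Continuous.intervalIntegrable (by fun_prop) _ _)
  have i2 := intervalIntegral.integral_mul_deriv_eq_deriv_mul (a := α) (b := M)
    (fun t _ => (h₂.hasDerivAt t).const_sub 1) (fun t _ => hexpn t)
    (Continuous.intervalIntegrable (by fun_prop) _ _)
    (Continuous.intervalIntegrable (by fun_prop) _ _)
  have e1 : ∀ t, -g₁ t * Real.exp (φ t) = -√(g₁ t * g₂ t) := fun t => by
    rw [sqrt_mul_of_ratio h₁ hg]; ring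
  have e2 : ∀ t, -g₂ t * Real.exp (-φ t) = -√(g₁ t * g₂ t) := fun t => by
    rw [sqrt_mul_of_ratio h₁ hg, hg, two_mul, Real.exp_add, Real.exp_neg]
    field_simp
  simp only [e1, e2, intervalIntegral.integral_neg, sub_neg_eq_add] at i1 i2
  have j1 : ∫ t in α..M, Real.exp (φ t) * φ' t * (1 - G₁ t) =
      ∫ t in α..M, (1 - G₁ t) * (Real.exp (φ t) * φ' t) := by simp_rw [mul_comm (1 - G₁ _)]
  have j2 : ∫ t in α..M, -(Real.exp (φ t) * φ' t) / Real.exp (φ t) ^ 2 * (1 - G₂ t) =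
      ∫ t in α..M, (1 - G₂ t) * (Real.exp (-φ t) * -φ' t) := by
    congr 1
    funext t
    rw [Real.exp_neg]
    field_simp
  have hV := sqrt_cdf_mul_of_ratio h₁ hα
  have hV2 : Real.exp (-φ α) * G₂ α = √(G₁ α * G₂ α) := by
    rw [hV, hα, ← mul_assoc, ← Real.exp_add]
    congr 2
    ring
  have b1 : (1 - G₁ M) * Real.exp (φ M) ≤ ∫ t in Set.Ioi M, √(g₁ t * g₂ t) := by
    rw [← h₁.integral_Ioi, ← integral_mul_const]
    refine setIntegral_mono_on (h₁.integrable.mul_const _).integrableOn hint.integrableOn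
      measurableSet_Ioi fun t ht => ?_
    rw [sqrt_mul_of_ratio h₁ hg, mul_comm]
    have ht' : M < t := ht
    exact mul_le_mul_of_nonneg_right (Real.exp_le_exp.2
      (hmono hαM (hαM.trans ht'.le) ht'.le)) (h₁.pdf_pos t).le
  have b2 : (1 - G₂ M) * Real.exp (-φ M) ≤ (1 - G₂ M) * Real.exp (-φ α) :=
    mul_le_mul_of_nonneg_left (Real.exp_le_exp.2 (neg_le_neg
      (hmono (Set.mem_Ici.2 le_rfl) hαM hαM))) (sub_nonneg.2 (h₂.lt_one M).le)
  rw [j1, j2, i1, i2, one_div, ← Real.exp_neg]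
  linarith

end Ratio

theorem normalPDF_eq_comp_affine {v : ℝ} (hv : 0 < v) (m x : ℝ) :
    normalPDF m v x = (√v)⁻¹ * normalPDF 0 1 ((√v)⁻¹ * (x - m)) := by
  unfold normalPDF
  rw [Real.sqrt_mul (by positivity), mul_inv, mul_one, ← mul_assoc, mul_comm (√v)⁻¹]
  congr 2
  rw [sub_zero, mul_pow, inv_pow, Real.sq_sqrt hv.le]
  field_simp

theorem isSmoothCdf_GP {X : Type*} [Fintype X] {P : X → ℝ} (hV : 0 < V P) :
    IsSmoothCdf (GP P) (NP P) := by
  convert isSmoothCdf_stdG.comp_affine (inv_pos.2 (Real.sqrt_pos.2 hV)) 0 using 1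
  · funext x
    rw [GP, sub_zero, mul_comm, div_eq_mul_inv]
  · funext x
    exact normalPDF_eq_comp_affine hV 0 x

theorem isSmoothCdf_GPQ {X Y : Type*} [Fintype X] [Fintype Y] {P : X → ℝ} {Q : Y → ℝ}
    (hP : 0 < H P) (hQ : 0 < H Q) (hV : 0 < V Q) (b : ℝ) :
    IsSmoothCdf (GPQ P Q b) (NPQ P Q b) := by
  have hv : 0 < H P / H Q * V Q := by positivity
  convert isSmoothCdf_stdG.comp_affine (inv_pos.2 (Real.sqrt_pos.2 hv)) (H Q * b) using 1
  · funext x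
    have hinv : H Q / (H P * V Q) = (H P / H Q * V Q)⁻¹ := by field_simp
    rw [GPQ, hinv, Real.sqrt_inv]
  · funext x
    exact normalPDF_eq_comp_affine hv _ x

/-- Half the log-likelihood ratio of `N(m, v₂)` and `N(0, v₁)`. -/
noncomputable def halfLogRatio (v₁ v₂ m t : ℝ) : ℝ :=
  (Real.log (√(2 * Real.pi * v₁) / √(2 * Real.pi * v₂)) +
    (t ^ 2 / (2 * v₁) - (t - m) ^ 2 / (2 * v₂))) / 2

theorem normalPDF_ratio {v₁ v₂ : ℝ} (h₁ : 0 < v₁) (h₂ : 0 < v₂) (m t : ℝ) :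
    normalPDF m v₂ t = Real.exp (2 * halfLogRatio v₁ v₂ m t) * normalPDF 0 v₁ t := by
  have s1 : 0 < √(2 * Real.pi * v₁) := by positivity
  have s2 : 0 < √(2 * Real.pi * v₂) := by positivity
  unfold halfLogRatio normalPDF
  rw [mul_div_cancel₀ _ two_ne_zero, Real.exp_add, Real.exp_log (div_pos s1 s2), sub_zero,
    mul_mul_mul_comm, ← Real.exp_add]
  congr 1
  · field_simp
  · congr 1
    ring

theorem hasDerivAt_halfLogRatio (v₁ v₂ m t : ℝ) :
    HasDerivAt (halfLogRatio v₁ v₂ m) ((t / v₁ - (t - m) / v₂) / 2) t := by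
  have a1 := ((hasDerivAt_id t).pow 2).div_const (2 * v₁)
  have a2 := (((hasDerivAt_id t).sub_const m).pow 2).div_const (2 * v₂)
  refine (((a1.sub a2).const_add
    (Real.log (√(2 * Real.pi * v₁) / √(2 * Real.pi * v₂)))).div_const 2).congr_deriv ?_
  simp only [id, Nat.cast_ofNat, Nat.add_one_sub_one, pow_one, mul_one]
  rw [mul_div_mul_left _ _ two_ne_zero, mul_div_mul_left _ _ two_ne_zero]

theorem monotone_deriv_halfLogRatio {v₁ v₂ : ℝ} (h₁ : 0 < v₁) (h : v₁ ≤ v₂) (m : ℝ) :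
    Monotone fun t => (t / v₁ - (t - m) / v₂) / 2 := fun s t hst => by
  have hle : v₂⁻¹ ≤ v₁⁻¹ := inv_anti₀ h₁ h
  simp only [div_eq_mul_inv]
  nlinarith [mul_nonneg (sub_nonneg.2 hst) (sub_nonneg.2 hle)]

theorem convexOn_halfLogRatio {v₁ v₂ : ℝ} (h₁ : 0 < v₁) (h : v₁ ≤ v₂) (m : ℝ) :
    ConvexOn ℝ Set.univ (halfLogRatio v₁ v₂ m) := by
  refine Monotone.convexOn_univ_of_deriv
    (fun t => (hasDerivAt_halfLogRatio v₁ v₂ m t).differentiableAt) ?_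
  have : deriv (halfLogRatio v₁ v₂ m) = fun t => (t / v₁ - (t - m) / v₂) / 2 :=
    funext fun t => (hasDerivAt_halfLogRatio v₁ v₂ m t).deriv
  rw [this]
  exact monotone_deriv_halfLogRatio h₁ h m

/-- second order asymptotics in the case `H(P)/V(P) > H(Q)/V(Q)`. -/
theorem second_order_case_gt {X Y : Type*} [Fintype X] [Fintype Y]
    (P : X → ℝ) (Q : Y → ℝ) (hP : IsProb P) (hQ : IsProb Q)
    (hVP : 0 < V P) (hVQ : 0 < V Q)
    (hratio : H Q / V Q < H P / V P) (b : ℝ) (α : ℝ)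
    (hα : NP P α / NPQ P Q b α = GP P α / GPQ P Q b α) :
    Tendsto (fun n : ℕ =>
        FD (iid P n) (iid Q ⌊H P / H Q * n + b * Real.sqrt n⌋₊)) atTop
      (nhds (Real.sqrt (GP P α * GPQ P Q b α) + IPQinf P Q b - IPQ P Q b α)) ∧
    Tendsto (fun n : ℕ =>
        FM (iid P n) (iid Q ⌊H P / H Q * n + b * Real.sqrt n⌋₊)) atTop
      (nhds (Real.sqrt (GP P α * GPQ P Q b α) + IPQinf P Q b - IPQ P Q b α)) := by
  have hHP := entropy_pos hP hVP
  have hHQ := entropy_pos hQ hVQ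
  have hv₂ : 0 < H P / H Q * V Q := by positivity
  have hlt : V P < H P / H Q * V Q := by
    rw [div_lt_div_iff₀ hVQ hVP] at hratio
    rw [div_mul_eq_mul_div, lt_div_iff₀ hHQ]
    linarith
  have h₁ := isSmoothCdf_GP hVP
  have h₂ := isSmoothCdf_GPQ hHP hHQ hVQ b
  set φ := halfLogRatio (V P) (H P / H Q * V Q) (H Q * b) with hφdef
  have hφ := hasDerivAt_halfLogRatio (V P) (H P / H Q * V Q) (H Q * b)
  have hφ' := monotone_deriv_halfLogRatio hVP hlt.le (H Q * b)
  have hg : ∀ t, NPQ P Q b t = Real.exp (2 * φ t) * NP P t := normalPDF_ratio hVP hv₂ (H Q * b)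
  have hG : GPQ P Q b α = Real.exp (2 * φ α) * GP P α := by
    have p1 := (h₁.pdf_pos α).ne'
    have p2 := (h₂.pos α).ne'
    rw [div_eq_div_iff (h₂.pdf_pos α).ne' p2, hg] at hα
    refine mul_left_cancel₀ p1 ?_
    linear_combination hα
  have hint := h₁.integrable_sqrt_mul h₂
  have hvalue : √(GP P α * GPQ P Q b α) + IPQinf P Q b - IPQ P Q b α =
      √(GP P α * GPQ P Q b α) + ∫ t in Set.Ioi α, √(NP P t * NPQ P Q b t) := by
    rw [IPQinf, IPQ, ← intervalIntegral.integral_Iic_add_Ioi (b := α) hint.integrableOn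
      hint.integrableOn]
    ring
  rw [hvalue]
  have hs : Tendsto (fun n : ℕ => √(n : ℝ)) atTop atTop :=
    Real.tendsto_sqrt_atTop.comp tendsto_natCast_atTop_atTop
  have t₁ := tendsto_upMass_source hP hVP
  have t₂ := tendsto_upMass_target hQ hP hVP hVQ b
  have hle : ∀ n : ℕ, FD (iid P n) (iid Q ⌊H P / H Q * n + b * √n⌋₊) ≤
      FM (iid P n) (iid Q ⌊H P / H Q * n + b * √n⌋₊) := fun n => FD_le_FM (hP.iid _) (hQ.iid _)
  have lower : ∀ v < √(GP P α * GPQ P Q b α) + ∫ t in Set.Ioi α, √(NP P t * NPQ P Q b t),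
      ∀ᶠ n : ℕ in atTop, v < FD (iid P n) (iid Q ⌊H P / H Q * n + b * √n⌋₊) := fun v hv => by
    obtain ⟨w, hvw, hw⟩ := exists_between hv
    obtain ⟨k, σ, τ, hσ, hτ, hστ, hsum⟩ :=
      exists_grid_of_ratio h₁ h₂ (convexOn_halfLogRatio hVP hlt.le (H Q * b)) hg hG hw
    filter_upwards [eventually_le_FD (fun n => hP.iid n) (fun n => hQ.iid _) hs t₁ t₂
      h₁.strictMono k hσ hτ hστ hsum] with n hn
    exact hvw.trans_le hn
  have upper : ∀ v, √(GP P α * GPQ P Q b α) + ∫ t in Set.Ioi α, √(NP P t * NPQ P Q b t) < v →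
      ∀ᶠ n : ℕ in atTop, FM (iid P n) (iid Q ⌊H P / H Q * n + b * √n⌋₊) < v := fun v hv => by
    obtain ⟨w, hw, hwv⟩ := exists_between hv
    obtain ⟨M, hαM, hM⟩ := exists_dual_bound h₁ h₂ hφ hφ' (by fun_prop) hg hG hw
    have hφα := deriv_nonneg_of_ratio h₁ h₂ hφ hφ' hg hG
    have hφc : Continuous φ := continuous_iff_continuousAt.2 fun t => (hφ t).continuousAt
    filter_upwards [eventually_FM_le (fun n => hP.iid n) (fun n => hQ.iid _) hs t₁ t₂
      h₁.continuous h₂.strictMono hαM (fun t _ => (hφ t).exp)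
      (hφc.rexp.mul (by fun_prop)).continuousOn (fun t _ => Real.exp_pos _)
      (fun t ht => mul_nonneg (Real.exp_pos _).le (hφα.trans (hφ' ht.1))) hM] with n hn
    exact hn.trans_lt hwv
  constructor <;> rw [tendsto_order] <;> constructor
  · exact lower
  · exact fun v hv => (upper v hv).mono fun n hn => (hle n).trans_lt hn
  · exact fun v hv => (lower v hv).mono fun n hn => hn.trans_le (hle n)
  · exact upper

end RNG
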